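/- arXiv:1411.0347 — 5 statements merged into one kernel-verified Lean document; each statement's English description precedes it below -/
import Mathlib

section
/- For any convex set C ⊆ ℝ^d, any data matrix A ∈ ℝ^{n×d}, any data vector y ∈ ℝⁿ, and any sketching matrix S ∈ ℝ^{m×n}, if A x_LS ≠ 0 and Z₁(S) > 0, then the Hessian sketch solution x̂ satisfies ‖x̂ − x_LS‖_A ≤ (Z₂(S)/Z₁(S)) · ‖x_LS‖_A. -/
open MeasureTheory Matrix Finset

/-- Squared Euclidean norm of a vector. -/
noncomputable def sqNorm {k : ℕ} (v : Fin k → ℝ) : ℝ := ∑ i, (v i) ^ 2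

/-- Euclidean (ℓ₂) norm of a vector. -/
noncomputable def l2norm {k : ℕ} (v : Fin k → ℝ) : ℝ := Real.sqrt (sqNorm v)

/-- Prediction semi-norm ‖v‖_A = (1/√n)‖A v‖₂. -/
noncomputable def predNorm {n d : ℕ} (A : Matrix (Fin n) (Fin d) ℝ) (v : Fin d → ℝ) : ℝ :=
  l2norm (A.mulVec v) / Real.sqrt n

/-- Transformed tangent cone K_LS = {t · A(x − x_LS) : t ≥ 0, x ∈ C}. -/
def Kcone {n d : ℕ} (A : Matrix (Fin n) (Fin d) ℝ) (C : Set (Fin d → ℝ))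
    (xLS : Fin d → ℝ) : Set (Fin n → ℝ) :=
  {v | ∃ t : ℝ, 0 ≤ t ∧ ∃ x ∈ C, v = t • A.mulVec (x - xLS)}

/-- Z₁(S) = inf over unit-norm vectors of the cone of (1/m)‖S v‖₂². -/
noncomputable def Z1 {n m : ℕ} (S : Matrix (Fin m) (Fin n) ℝ) (K : Set (Fin n → ℝ)) : ℝ :=
  sInf ((fun v => (1 / (m : ℝ)) * sqNorm (S.mulVec v)) '' {v ∈ K | l2norm v = 1})

/-- Z₂(S) = sup over unit-norm vectors of the cone of |⟨u, (SᵀS/m − I) v⟩|. -/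
noncomputable def Z2 {n m : ℕ} (S : Matrix (Fin m) (Fin n) ℝ) (K : Set (Fin n → ℝ))
    (u : Fin n → ℝ) : ℝ :=
  sSup ((fun v => |u ⬝ᵥ (((1 / (m : ℝ)) • (Sᵀ * S) - 1).mulVec v)|) '' {v ∈ K | l2norm v = 1})

lemma sqNorm_eq_dot {k : ℕ} (v : Fin k → ℝ) : sqNorm v = v ⬝ᵥ v := by
  simp [sqNorm, dotProduct, pow_two]

lemma sqNorm_nonneg' {k : ℕ} (v : Fin k → ℝ) : 0 ≤ sqNorm v :=
  Finset.sum_nonneg fun _ _ => sq_nonneg _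

lemma sqNorm_smul' {k : ℕ} (t : ℝ) (v : Fin k → ℝ) : sqNorm (t • v) = t ^ 2 * sqNorm v := by
  simp [sqNorm, mul_pow, Finset.mul_sum]

lemma sqNorm_add_smul' {k : ℕ} (p q : Fin k → ℝ) (t : ℝ) :
    sqNorm (p + t • q) = sqNorm p + 2 * t * (p ⬝ᵥ q) + t ^ 2 * sqNorm q := by
  simp only [sqNorm, dotProduct, Finset.mul_sum, ← Finset.sum_add_distrib]
  refine Finset.sum_congr rfl fun i _ => ?_
  simp only [Pi.add_apply, Pi.smul_apply, smul_eq_mul]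
  ring

lemma first_order {b c : ℝ} (h : ∀ t : ℝ, 0 < t → t ≤ 1 → 0 ≤ t * b + t ^ 2 * c) : 0 ≤ b := by
  by_contra hb
  push Not at hb
  have hc := abs_nonneg c
  have hD : 0 < |c| - b := by linarith
  have ht : 0 < -b / (|c| - b) := div_pos (by linarith) hD
  have h1 := h _ ht ((div_le_one hD).2 (by linarith))
  set t := -b / (|c| - b) with htd
  have hte : t * (|c| - b) = -b := by rw [htd]; field_simp
  have h2 : 0 ≤ b + t * c := by
    by_contra h3
    push Not at h3
    nlinarith [mul_neg_of_pos_of_neg ht h3]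
  have h4 : t * c ≤ t * |c| := mul_le_mul_of_nonneg_left (le_abs_self c) ht.le
  nlinarith [mul_neg_of_pos_of_neg ht hb]

lemma Z2_bdd {n m : ℕ} (S : Matrix (Fin m) (Fin n) ℝ) (K : Set (Fin n → ℝ)) (u : Fin n → ℝ) :
    BddAbove ((fun v => |u ⬝ᵥ (((1 / (m : ℝ)) • (Sᵀ * S) - 1).mulVec v)|) ''
      {v ∈ K | l2norm v = 1}) := by
  have hcont : Continuous (fun v : Fin n → ℝ =>
      |u ⬝ᵥ (((1 / (m : ℝ)) • (Sᵀ * S) - 1).mulVec v)|) :=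
    (continuous_const.dotProduct (continuous_const.matrix_mulVec continuous_id)).abs
  have hk : IsCompact (Set.Icc (fun _ : Fin n => (-1 : ℝ)) (fun _ => 1)) := isCompact_Icc
  refine (hk.bddAbove_image hcont.continuousOn).mono (Set.image_mono ?_)
  rintro v ⟨-, hv⟩
  have hs : sqNorm v = 1 := by
    have := Real.sq_sqrt (sqNorm_nonneg' v)
    rw [l2norm] at hv
    rw [hv] at this
    linarith
  have hi : ∀ i, |v i| ≤ 1 := fun i => by
    have : v i ^ 2 ≤ sqNorm v :=
      Finset.single_le_sum (f := fun i => v i ^ 2) (fun _ _ => sq_nonneg _) (Finset.mem_univ i)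
    rw [hs] at this
    exact (sq_le_one_iff_abs_le_one _).1 this
  exact ⟨fun i => (abs_le.1 (hi i)).1, fun i => (abs_le.1 (hi i)).2⟩

/-- bound on the Hessian sketch solution (Proposition 1). -/
theorem hessian_sketch_bound
    {n d m : ℕ} (hn : 0 < n) (hm : 0 < m)
    (C : Set (Fin d → ℝ)) (hC : Convex ℝ C)
    (A : Matrix (Fin n) (Fin d) ℝ) (y : Fin n → ℝ)
    (S : Matrix (Fin m) (Fin n) ℝ)
    (xLS : Fin d → ℝ) (hLSmem : xLS ∈ C)
    (hLSmin : ∀ x ∈ C,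
      (1 / (2 * (n : ℝ))) * sqNorm (A.mulVec xLS - y)
        ≤ (1 / (2 * (n : ℝ))) * sqNorm (A.mulVec x - y))
    (xhat : Fin d → ℝ) (hhatmem : xhat ∈ C)
    (hhatmin : ∀ x ∈ C,
      (1 / (2 * (m : ℝ))) * sqNorm (S.mulVec (A.mulVec xhat)) - (Aᵀ.mulVec y) ⬝ᵥ xhat
        ≤ (1 / (2 * (m : ℝ))) * sqNorm (S.mulVec (A.mulVec x)) - (Aᵀ.mulVec y) ⬝ᵥ x)
    (hA : A.mulVec xLS ≠ 0)
    (hZ1 : 0 < Z1 S (Kcone A C xLS)) :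
    predNorm A (xhat - xLS) ≤
      (Z2 S (Kcone A C xLS) ((l2norm (A.mulVec xLS))⁻¹ • A.mulVec xLS)
          / Z1 S (Kcone A C xLS)) * predNorm A xLS := by
  have hn' : (0 : ℝ) < n := by exact_mod_cast hn
  have hm' : (0 : ℝ) < m := by exact_mod_cast hm
  set K := Kcone A C xLS with hK
  set w := A.mulVec xLS with hw
  set Δ := A.mulVec (xhat - xLS) with hΔ
  set u := (l2norm w)⁻¹ • w with hu
  have hhat : A.mulVec xhat = w + Δ := by
    rw [hw, hΔ, mulVec_sub]; abel
  have hZ2 : 0 ≤ Z2 S K u := by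
    apply Real.sSup_nonneg
    rintro _ ⟨v, -, rfl⟩
    exact abs_nonneg _
  -- first-order optimality of the least-squares solution
  have hfo1 : 0 ≤ (w - y) ⬝ᵥ Δ := by
    have : 0 ≤ 2 * ((w - y) ⬝ᵥ Δ) := by
      apply first_order (c := sqNorm Δ)
      intro t h0 h1
      have hx := hC.add_smul_sub_mem hLSmem hhatmem ⟨h0.le, h1⟩
      have h := le_of_mul_le_mul_left (hLSmin _ hx) (by positivity)
      have e : A.mulVec (xLS + t • (xhat - xLS)) - y = (w - y) + t • Δ := by
        rw [mulVec_add, mulVec_smul]; abel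
      rw [e, sqNorm_add_smul'] at h
      linarith
    linarith
  -- first-order optimality of the sketched solution
  have hfo2 : (1 / (m : ℝ)) * (S.mulVec (w + Δ) ⬝ᵥ S.mulVec Δ) ≤ y ⬝ᵥ Δ := by
    have : 0 ≤ y ⬝ᵥ Δ - (1 / (m : ℝ)) * (S.mulVec (w + Δ) ⬝ᵥ S.mulVec Δ) := by
      apply first_order (c := (1 / (2 * (m : ℝ))) * sqNorm (S.mulVec Δ))
      intro t h0 h1
      have hx := hC.add_smul_sub_mem hhatmem hLSmem ⟨h0.le, h1⟩
      have h := hhatmin _ hx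
      have e0 : xhat + t • (xLS - xhat) = xhat + (-t) • (xhat - xLS) := by
        rw [neg_smul, ← smul_neg, neg_sub]
      have e1 : S.mulVec (A.mulVec (xhat + t • (xLS - xhat)))
          = S.mulVec (w + Δ) + (-t) • S.mulVec Δ := by
        rw [e0, mulVec_add, mulVec_smul, hhat, mulVec_add, mulVec_smul]
      have e2 : (Aᵀ.mulVec y) ⬝ᵥ (xhat + t • (xLS - xhat))
          = (Aᵀ.mulVec y) ⬝ᵥ xhat - t * (y ⬝ᵥ Δ) := by
        have : (Aᵀ.mulVec y) ⬝ᵥ (xhat - xLS) = y ⬝ᵥ Δ := by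
          rw [mulVec_transpose, ← dotProduct_mulVec]
        rw [e0, dotProduct_add, dotProduct_smul, this, smul_eq_mul]
        ring
      rw [e1, e2, sqNorm_add_smul', hhat] at h
      have e3 : (1 / (2 * (m : ℝ))) * (2 * -t * (S.mulVec (w + Δ) ⬝ᵥ S.mulVec Δ))
          = - (t * ((1 / (m : ℝ)) * (S.mulVec (w + Δ) ⬝ᵥ S.mulVec Δ))) := by
        field_simp
      nlinarith [h, e3]
    linarith
  have hM : ∀ v, w ⬝ᵥ (((1 / (m : ℝ)) • (Sᵀ * S) - 1).mulVec v)
      = (1 / (m : ℝ)) * (S.mulVec w ⬝ᵥ S.mulVec v) - w ⬝ᵥ v := by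
    intro v
    rw [sub_mulVec, smul_mulVec, one_mulVec, dotProduct_sub, dotProduct_smul, smul_eq_mul,
      ← mulVec_mulVec, dotProduct_mulVec w, vecMul_transpose]
  have hbasic : (1 / (m : ℝ)) * sqNorm (S.mulVec Δ)
      ≤ |w ⬝ᵥ (((1 / (m : ℝ)) • (Sᵀ * S) - 1).mulVec Δ)| := by
    refine le_trans ?_ (neg_le_abs _)
    rw [hM]
    rw [mulVec_add, add_dotProduct, ← sqNorm_eq_dot, mul_add] at hfo2
    rw [sub_dotProduct] at hfo1
    linarith
  have hwpos : 0 < l2norm w := by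
    apply Real.sqrt_pos.2
    refine lt_of_le_of_ne (sqNorm_nonneg' w) fun h => hA ?_
    rw [sqNorm_eq_dot] at h
    exact dotProduct_self_eq_zero.1 h.symm
  have hmain : l2norm Δ ≤ Z2 S K u / Z1 S K * l2norm w := by
    rcases (Real.sqrt_nonneg (sqNorm Δ)).eq_or_lt with h0 | hpos
    · rw [l2norm, ← h0]
      positivity
    change 0 < l2norm Δ at hpos
    set r := l2norm Δ with hr
    have hr2 : r ^ 2 = sqNorm Δ := Real.sq_sqrt (sqNorm_nonneg' Δ)
    have hvmem : r⁻¹ • Δ ∈ {v ∈ K | l2norm v = 1} := by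
      refine ⟨⟨r⁻¹, by positivity, xhat, hhatmem, rfl⟩, ?_⟩
      rw [l2norm, sqNorm_smul', ← hr2, ← mul_pow, inv_mul_cancel₀ hpos.ne']
      simp
    have hz1 : Z1 S K ≤ (1 / (m : ℝ)) * sqNorm (S.mulVec (r⁻¹ • Δ)) := by
      refine csInf_le ⟨0, ?_⟩ ⟨_, hvmem, rfl⟩
      rintro _ ⟨v, -, rfl⟩
      exact mul_nonneg (by positivity) (sqNorm_nonneg' _)
    have hz2 : |u ⬝ᵥ (((1 / (m : ℝ)) • (Sᵀ * S) - 1).mulVec (r⁻¹ • Δ))| ≤ Z2 S K u :=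
      le_csSup (Z2_bdd S K u) ⟨_, hvmem, rfl⟩
    rw [mulVec_smul, sqNorm_smul'] at hz1
    rw [mulVec_smul, hu, smul_dotProduct, dotProduct_smul, smul_eq_mul, smul_eq_mul, abs_mul,
      abs_mul, abs_of_pos (inv_pos.2 hwpos), abs_of_pos (inv_pos.2 hpos), ← hu] at hz2
    have hz1' : Z1 S K * r ^ 2 ≤ (1 / (m : ℝ)) * sqNorm (S.mulVec Δ) := by
      calc Z1 S K * r ^ 2
          ≤ (1 / (m : ℝ)) * (r⁻¹ ^ 2 * sqNorm (S.mulVec Δ)) * r ^ 2 := by gcongr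
        _ = _ := by field_simp
    have hz2' : |w ⬝ᵥ (((1 / (m : ℝ)) • (Sᵀ * S) - 1).mulVec Δ)|
        ≤ Z2 S K u * l2norm w * r := by
      calc _ = ((l2norm w)⁻¹ * (r⁻¹ * |w ⬝ᵥ (((1 / (m : ℝ)) • (Sᵀ * S) - 1).mulVec Δ)|))
            * l2norm w * r := by field_simp
        _ ≤ _ := by gcongr
    have hfin : Z1 S K * r ≤ Z2 S K u * l2norm w := by
      refine le_of_mul_le_mul_right ?_ hpos
      linarith [hz1'.trans (hbasic.trans hz2')]
    rw [div_mul_eq_mul_div, le_div_iff₀ hZ1]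
    linarith
  rw [predNorm, predNorm, ← mul_div_assoc]
  exact div_le_div_of_nonneg_right hmain (Real.sqrt_nonneg _)
end

section
/- For any convex set C ⊆ ℝ^d, any A ∈ ℝ^{n×d}, any y ∈ ℝⁿ, any sketching matrix S ∈ ℝ^{m×n} with A x_LS ≠ 0, and any ρ ∈ (0, 1/2], if Z₁(S) ≥ 1 − ρ and Z₂(S) ≤ ρ/2, then the Hessian sketch solution x̂ satisfies ‖x̂ − x_LS‖_A ≤ (ρ/(2(1−ρ))) · ‖x_LS‖_A ≤ ρ · ‖x_LS‖_A. -/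
open MeasureTheory Matrix Finset

theorem aux_sqNorm_add {k : ℕ} (a e : Fin k → ℝ) (t : ℝ) :
    sqNorm (a + t • e) = sqNorm a + 2 * t * (a ⬝ᵥ e) + t ^ 2 * sqNorm e := by
  simp only [sqNorm, dotProduct, Finset.mul_sum, ← Finset.sum_add_distrib]
  refine Finset.sum_congr rfl fun i _ => ?_
  simp only [Pi.add_apply, Pi.smul_apply, smul_eq_mul]
  ring

theorem aux_sqNorm_smul {k : ℕ} (e : Fin k → ℝ) (t : ℝ) :
    sqNorm (t • e) = t ^ 2 * sqNorm e := by
  simp only [sqNorm, Finset.mul_sum]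
  refine Finset.sum_congr rfl fun i _ => ?_
  simp only [Pi.smul_apply, smul_eq_mul]
  ring

theorem aux_sqNorm_nonneg {k : ℕ} (e : Fin k → ℝ) : 0 ≤ sqNorm e :=
  Finset.sum_nonneg fun i _ => sq_nonneg _

theorem aux_l2norm_sq {k : ℕ} (e : Fin k → ℝ) : l2norm e ^ 2 = sqNorm e :=
  Real.sq_sqrt (aux_sqNorm_nonneg e)

theorem aux_first_order (p q : ℝ) (h : ∀ t : ℝ, 0 < t → t ≤ 1 → 0 ≤ t * p + t ^ 2 * q) :
    0 ≤ p := by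
  by_contra hp
  push Not at hp
  have hq : 0 < |q| + 1 := by positivity
  have hd : 0 < -p + (|q| + 1) := by linarith
  have ht : 0 < -p / (-p + (|q| + 1)) := div_pos (by linarith) hd
  have ht1 : -p / (-p + (|q| + 1)) ≤ 1 := by rw [div_le_one hd]; linarith
  have h1 := h _ ht ht1
  set t := -p / (-p + (|q| + 1)) with htd
  have h2 : 0 ≤ p + t * q := by
    by_contra hc
    push Not at hc
    nlinarith
  have h3 : t * (-p + (|q| + 1)) = -p := by rw [htd]; field_simp
  nlinarith [le_abs_self q, mul_pos ht (neg_pos.mpr hp)]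

theorem aux_bdd {k : ℕ} (w : Fin k → ℝ) (v : Fin k → ℝ) (hv : l2norm v = 1) :
    |w ⬝ᵥ v| ≤ ∑ i, |w i| := by
  refine (Finset.abs_sum_le_sum_abs _ _).trans (Finset.sum_le_sum fun i _ => ?_)
  have h1 : sqNorm v = 1 := by rw [← aux_l2norm_sq, hv]; norm_num
  have h2 : (v i) ^ 2 ≤ 1 := by
    rw [← h1]
    exact Finset.single_le_sum (f := fun i => (v i) ^ 2) (fun j _ => sq_nonneg _)
      (Finset.mem_univ i)
  have h3 : |v i| ≤ 1 := by rwa [sq_le_one_iff_abs_le_one] at h2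
  rw [abs_mul]
  exact mul_le_of_le_one_right (abs_nonneg _) h3

/-- high-probability-event form of the Hessian sketch bound. -/
theorem hessian_sketch_rho_bound
    {n d m : ℕ} (hn : 0 < n) (hm : 0 < m)
    (C : Set (Fin d → ℝ)) (hC : Convex ℝ C)
    (A : Matrix (Fin n) (Fin d) ℝ) (y : Fin n → ℝ)
    (S : Matrix (Fin m) (Fin n) ℝ)
    (xLS : Fin d → ℝ) (hLSmem : xLS ∈ C)
    (hLSmin : ∀ x ∈ C,
      (1 / (2 * (n : ℝ))) * sqNorm (A.mulVec xLS - y)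
        ≤ (1 / (2 * (n : ℝ))) * sqNorm (A.mulVec x - y))
    (xhat : Fin d → ℝ) (hhatmem : xhat ∈ C)
    (hhatmin : ∀ x ∈ C,
      (1 / (2 * (m : ℝ))) * sqNorm (S.mulVec (A.mulVec xhat)) - (Aᵀ.mulVec y) ⬝ᵥ xhat
        ≤ (1 / (2 * (m : ℝ))) * sqNorm (S.mulVec (A.mulVec x)) - (Aᵀ.mulVec y) ⬝ᵥ x)
    (hA : A.mulVec xLS ≠ 0)
    (ρ : ℝ) (hρ : ρ ∈ Set.Ioc (0 : ℝ) (1 / 2))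
    (hZ1 : 1 - ρ ≤ Z1 S (Kcone A C xLS))
    (hZ2 : Z2 S (Kcone A C xLS) ((l2norm (A.mulVec xLS))⁻¹ • A.mulVec xLS) ≤ ρ / 2) :
    predNorm A (xhat - xLS) ≤ (ρ / (2 * (1 - ρ))) * predNorm A xLS ∧
      (ρ / (2 * (1 - ρ))) * predNorm A xLS ≤ ρ * predNorm A xLS := by
  obtain ⟨hρ0, hρ1⟩ := hρ
  have hn' : (0 : ℝ) < n := by exact_mod_cast hn
  have hm' : (0 : ℝ) < m := by exact_mod_cast hm
  have hPn : 0 ≤ predNorm A xLS := div_nonneg (Real.sqrt_nonneg _) (Real.sqrt_nonneg _)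
  have hfac : ρ / (2 * (1 - ρ)) ≤ ρ := by
    rw [div_le_iff₀ (by linarith)]
    nlinarith
  refine ⟨?_, mul_le_mul_of_nonneg_right hfac hPn⟩
  suffices hmain : l2norm (A.mulVec (xhat - xLS)) ≤ (ρ / (2 * (1 - ρ))) * l2norm (A.mulVec xLS) by
    unfold predNorm
    rw [← mul_div_assoc]
    exact div_le_div_of_nonneg_right hmain (Real.sqrt_nonneg _)
  set a := A.mulVec xLS with ha
  set e := A.mulVec (xhat - xLS) with he
  have hae : A.mulVec xhat = a + e := by rw [ha, he, ← mulVec_add]; congr 1; abel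
  have hxt : ∀ t : ℝ, A.mulVec (xLS + t • (xhat - xLS)) = a + t • e := by
    intro t; rw [mulVec_add, mulVec_smul]
  have hxC : ∀ t : ℝ, 0 < t → t ≤ 1 → xLS + t • (xhat - xLS) ∈ C := fun t h0 h1 =>
    hC.add_smul_sub_mem hLSmem hhatmem ⟨h0.le, h1⟩
  have hxC' : ∀ t : ℝ, 0 < t → t ≤ 1 → xhat + t • (xLS - xhat) ∈ C := fun t h0 h1 =>
    hC.add_smul_sub_mem hhatmem hLSmem ⟨h0.le, h1⟩
  -- optimality of xLS
  have h1 : 0 ≤ 2 * ((a - y) ⬝ᵥ e) := by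
    refine aux_first_order _ (sqNorm e) fun t h0 ht1 => ?_
    have h := hLSmin _ (hxC t h0 ht1)
    rw [hxt] at h
    have h' := le_of_mul_le_mul_left h (by positivity)
    have h2 : a + t • e - y = (a - y) + t • e := by abel
    rw [h2, aux_sqNorm_add] at h'
    linarith
  -- optimality of xhat
  have hy : ∀ x, (Aᵀ.mulVec y) ⬝ᵥ x = y ⬝ᵥ A.mulVec x := by
    intro x; rw [mulVec_transpose, dotProduct_mulVec]
  have h2 : 0 ≤ -((1 / (m : ℝ)) * (S.mulVec (a + e) ⬝ᵥ S.mulVec e) - y ⬝ᵥ e) := by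
    refine aux_first_order _ ((1 / (2 * (m : ℝ))) * sqNorm (S.mulVec e)) fun t h0 ht1 => ?_
    have h := hhatmin _ (hxC' t h0 ht1)
    have h3 : A.mulVec (xhat + t • (xLS - xhat)) = (a + e) + (-t) • e := by
      have : xhat + t • (xLS - xhat) = xhat + (-t) • (xhat - xLS) := by
        rw [neg_smul, ← smul_neg, neg_sub]
      rw [this, mulVec_add, mulVec_smul, hae]
    rw [hy, hy, h3, hae, mulVec_add S (a + e), mulVec_smul, aux_sqNorm_add,
      dotProduct_add y (a + e), dotProduct_smul, smul_eq_mul] at h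
    have h4 : (1 / (2 * (m : ℝ))) * 2 = 1 / (m : ℝ) := by field_simp
    rw [← h4]
    nlinarith
  by_cases he0 : sqNorm e = 0
  · have : l2norm e = 0 := by rw [l2norm, he0, Real.sqrt_zero]
    rw [this]
    exact mul_nonneg (div_nonneg hρ0.le (by linarith)) (Real.sqrt_nonneg _)
  have hepos : 0 < l2norm e :=
    Real.sqrt_pos.mpr (lt_of_le_of_ne (aux_sqNorm_nonneg e) (Ne.symm he0))
  have hapos : 0 < l2norm a := by
    refine Real.sqrt_pos.mpr (lt_of_le_of_ne (aux_sqNorm_nonneg a) (Ne.symm fun h => hA ?_))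
    rw [sqNorm, Finset.sum_eq_zero_iff_of_nonneg (fun i _ => sq_nonneg _)] at h
    funext i
    exact pow_eq_zero_iff (two_ne_zero) |>.mp (h i (Finset.mem_univ i))
  set N := l2norm e with hN
  set L := l2norm a with hL
  have hv : N⁻¹ • e ∈ {v ∈ Kcone A C xLS | l2norm v = 1} := by
    refine ⟨⟨N⁻¹, by positivity, xhat, hhatmem, rfl⟩, ?_⟩
    rw [l2norm, aux_sqNorm_smul, ← aux_l2norm_sq, ← hN, ← mul_pow, inv_mul_cancel₀ hepos.ne']
    simp
  have hz1 : 1 - ρ ≤ (1 / (m : ℝ)) * sqNorm (S.mulVec (N⁻¹ • e)) := by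
    refine hZ1.trans (csInf_le ⟨0, ?_⟩ ⟨_, hv, rfl⟩)
    rintro _ ⟨v, -, rfl⟩
    exact mul_nonneg (by positivity) (aux_sqNorm_nonneg _)
  have hz2 : |(L⁻¹ • a) ⬝ᵥ (((1 / (m : ℝ)) • (Sᵀ * S) - 1).mulVec (N⁻¹ • e))| ≤ ρ / 2 := by
    refine hZ2.trans' (le_csSup ⟨∑ i, |((L⁻¹ • a) ᵥ* ((1 / (m : ℝ)) • (Sᵀ * S) - 1)) i|, ?_⟩
      ⟨_, hv, rfl⟩)
    rintro _ ⟨v, hv, rfl⟩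
    simp only [dotProduct_mulVec]
    exact aux_bdd _ _ hv.2
  have hM : a ⬝ᵥ (((1 / (m : ℝ)) • (Sᵀ * S) - 1).mulVec e)
      = (1 / (m : ℝ)) * (S.mulVec a ⬝ᵥ S.mulVec e) - a ⬝ᵥ e := by
    rw [sub_mulVec, smul_mulVec, one_mulVec, dotProduct_sub, dotProduct_smul, smul_eq_mul,
      ← mulVec_mulVec, dotProduct_mulVec a, vecMul_transpose]
  rw [mulVec_smul, dotProduct_smul, smul_dotProduct, hM, smul_eq_mul, smul_eq_mul] at hz2
  rw [mulVec_smul, aux_sqNorm_smul] at hz1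
  have hself : sqNorm (S.mulVec e) = S.mulVec e ⬝ᵥ S.mulVec e := by
    simp only [sqNorm, dotProduct, sq]
  rw [mulVec_add, add_dotProduct, ← hself] at h2
  rw [sub_dotProduct] at h1
  have hz2' := (abs_le.mp hz2).1
  set Q := S.mulVec a ⬝ᵥ S.mulVec e
  set R := sqNorm (S.mulVec e)
  have k1 : (1 - ρ) * N ^ 2 ≤ (1 / (m : ℝ)) * R := by
    have := mul_le_mul_of_nonneg_right hz1 (sq_nonneg N)
    have e1 : (1 / (m : ℝ)) * (N⁻¹ ^ 2 * R) * N ^ 2 = (1 / (m : ℝ)) * R := by field_simp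
    rwa [e1] at this
  have k2 : -(ρ / 2) * (N * L) ≤ (1 / (m : ℝ)) * Q - a ⬝ᵥ e := by
    have := mul_le_mul_of_nonneg_right hz2' (mul_pos hepos hapos).le
    have e1 : N⁻¹ * (L⁻¹ * ((1 / (m : ℝ)) * Q - a ⬝ᵥ e)) * (N * L)
        = (1 / (m : ℝ)) * Q - a ⬝ᵥ e := by
      generalize (1 / (m : ℝ)) * Q - a ⬝ᵥ e = z
      field_simp
    rwa [e1] at this
  have k3 : N * ((1 - ρ) * N) ≤ N * (ρ / 2 * L) := by
    rw [mul_add] at h2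
    linarith
  have k4 := le_of_mul_le_mul_left k3 hepos
  have e2 : ρ / (2 * (1 - ρ)) * L = (ρ / 2 * L) / (1 - ρ) := by
    have : (1 - ρ) ≠ 0 := (show (0 : ℝ) < 1 - ρ by linarith).ne'
    field_simp
  rw [e2, le_div_iff₀ (by linarith)]
  linarith
end

section
/- Let m ≤ n and let S be a random m×n real matrix whose entries are i.i.d. standard normal N(0,1). Then S Sᵀ is almost surely invertible and E[Sᵀ (S Sᵀ)⁻¹ S] = (m/n)·Iₙ, i.e. for every pair of indices (i, j), the expectation of the (i,j) entry of Sᵀ(S Sᵀ)⁻¹S equals m/n if i = j and 0 otherwise. -/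
open MeasureTheory Matrix

instance {m n : ℕ} : MeasurableSpace (Matrix (Fin m) (Fin n) ℝ) :=
  inferInstanceAs (MeasurableSpace (Fin m → Fin n → ℝ))

/-- Measure on m×n matrices with i.i.d. standard normal N(0,1) entries. -/
noncomputable def stdGaussMatrix (m n : ℕ) : Measure (Matrix (Fin m) (Fin n) ℝ) :=
  Measure.pi fun _ : Fin m => Measure.pi fun _ : Fin n => ProbabilityTheory.gaussianReal 0 1

theorem pi_ac {α : Type*} [MeasurableSpace α] (μ ν : Measure α) [SigmaFinite μ] [SigmaFinite ν]
    (h : μ ≪ ν) (k : ℕ) :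
    (Measure.pi fun _ : Fin k => μ) ≪ (Measure.pi fun _ : Fin k => ν) := by
  induction k with
  | zero =>
    rw [Measure.pi_of_empty, Measure.pi_of_empty]
  | succ k ih =>
    have h1 := (measurePreserving_piFinSuccAbove (fun _ : Fin (k+1) => μ) 0).symm
    have h2 := (measurePreserving_piFinSuccAbove (fun _ : Fin (k+1) => ν) 0).symm
    rw [← h1.map_eq, ← h2.map_eq]
    exact (h.prod ih).map h1.measurable

theorem gm_ac (m n : ℕ) :
    stdGaussMatrix m n ≪ (volume : Measure (Fin m → Fin n → ℝ)) := by
  unfold stdGaussMatrix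
  exact pi_ac _ _ (pi_ac _ _ (ProbabilityTheory.gaussianReal_absolutelyContinuous 0 one_ne_zero) n) m

instance gm_prob (m n : ℕ) : IsProbabilityMeasure (stdGaussMatrix m n) := by
  unfold stdGaussMatrix
  exact inferInstanceAs (IsProbabilityMeasure
    (Measure.pi fun _ : Fin m => Measure.pi fun _ : Fin n => ProbabilityTheory.gaussianReal 0 1))

theorem det_gram_ne_zero {m n : ℕ} (hmn : m ≤ n) (S : Matrix (Fin m) (Fin n) ℝ)
    (h : (S.submatrix id (Fin.castLE hmn)).det ≠ 0) : (S * Sᵀ).det ≠ 0 := by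
  intro h0
  obtain ⟨v, hv, hv0⟩ := Matrix.exists_mulVec_eq_zero_iff.2 h0
  have h1 : (Sᵀ *ᵥ v) ⬝ᵥ (Sᵀ *ᵥ v) = 0 := by
    have : v ⬝ᵥ ((S * Sᵀ) *ᵥ v) = 0 := by rw [hv0]; simp
    rw [← Matrix.mulVec_mulVec, Matrix.dotProduct_mulVec] at this
    rwa [Matrix.mulVec_transpose] at this ⊢
  have h2 : Sᵀ *ᵥ v = 0 := dotProduct_self_eq_zero.1 h1
  apply h
  rw [← Matrix.det_transpose]
  apply Matrix.exists_mulVec_eq_zero_iff.1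
  refine ⟨v, hv, ?_⟩
  ext i
  exact congrFun h2 (Fin.castLE hmn i)

theorem gm_ae (m n : ℕ) (hmn : m ≤ n) :
    ∀ᵐ x : Fin m → Fin n → ℝ, x ∈ {x : Fin m → Fin n → ℝ |
      ((Matrix.of x).submatrix id (Fin.castLE hmn)).det ≠ 0} := by
  let E : Fin m → Fin n → ℝ := fun a b => if Fin.castLE hmn a = b then 1 else 0
  refine ae_mem_of_ae_add_linearMap_mem (𝕜 := ℝ) (LinearMap.toSpanSingleton ℝ _ E)
    (volume : Measure ℝ) volume ?_ ?_
  · refine IsOpen.measurableSet (isOpen_ne_fun ?_ continuous_const)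
    refine Continuous.matrix_det ?_
    refine continuous_pi fun a => continuous_pi fun b => ?_
    simp only [Matrix.submatrix_apply, Matrix.of_apply]
    fun_prop
  · intro y
    let A := (Matrix.of y).submatrix id (Fin.castLE hmn)
    have hf : ({t : ℝ | (-A).charpoly.IsRoot t}).Finite :=
      Polynomial.finite_setOfPred_isRoot (Matrix.charpoly_monic _).ne_zero
    filter_upwards [hf.countable.ae_notMem volume] with t ht
    simp only [Polynomial.IsRoot, Matrix.eval_charpoly] at ht ⊢
    convert ht using 2
    ext a b
    simp [A, E, Matrix.diagonal_apply, Matrix.scalar_apply, add_comm]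

theorem gm_ae_det {m n : ℕ} (hmn : m ≤ n) :
    ∀ᵐ S ∂stdGaussMatrix m n, (S * Sᵀ).det ≠ 0 := by
  have := (gm_ac m n).ae_le (gm_ae m n hmn)
  filter_upwards [this] with S hS
  exact det_gram_ne_zero hmn S hS

/-- The projection matrix. -/
noncomputable def projM {m n : ℕ} (S : Matrix (Fin m) (Fin n) ℝ) : Matrix (Fin n) (Fin n) ℝ :=
  Sᵀ * (S * Sᵀ)⁻¹ * S

theorem projM_meas {m n : ℕ} (i j : Fin n) :
    Measurable (fun S : Matrix (Fin m) (Fin n) ℝ => projM S i j) := by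
  have h : (fun S : Matrix (Fin m) (Fin n) ℝ => projM S i j) =
      fun S => ((S * Sᵀ).det)⁻¹ * (Sᵀ * (S * Sᵀ).adjugate * S) i j := by
    funext S
    simp [projM, Matrix.inv_def]
  rw [h]
  have c1 : Continuous (fun S : Matrix (Fin m) (Fin n) ℝ => (S * Sᵀ).det) := by
    fun_prop
  have c2 : Continuous (fun S : Matrix (Fin m) (Fin n) ℝ =>
      (Sᵀ * (S * Sᵀ).adjugate * S) i j) := by
    fun_prop
  have : BorelSpace (Matrix (Fin m) (Fin n) ℝ) := inferInstanceAs (BorelSpace (Fin m → Fin n → ℝ))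
  exact c1.measurable.inv.mul c2.measurable

theorem projM_diag_nonneg {m n : ℕ} (S : Matrix (Fin m) (Fin n) ℝ) (i : Fin n) :
    0 ≤ projM S i i := by
  have h := (((Matrix.posSemidef_self_mul_conjTranspose S).inv).conjTranspose_mul_mul_same S)
  simpa [projM] using h.diag_nonneg (i := i)

theorem projM_trace {m n : ℕ} (S : Matrix (Fin m) (Fin n) ℝ) (h : (S * Sᵀ).det ≠ 0) :
    ∑ i, projM S i i = m := by
  have : (projM S).trace = m := by
    rw [projM, Matrix.mul_assoc, Matrix.trace_mul_comm, Matrix.mul_assoc,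
      Matrix.nonsing_inv_mul _ (isUnit_iff_ne_zero.2 h)]
    simp
  exact this

theorem gm_integrable {m n : ℕ} (hmn : m ≤ n) (i : Fin n) :
    Integrable (fun S => projM S i i) (stdGaussMatrix m n) := by
  refine Integrable.of_bound (projM_meas i i).aestronglyMeasurable (m : ℝ) ?_
  filter_upwards [gm_ae_det hmn] with S hS
  rw [Real.norm_of_nonneg (projM_diag_nonneg S i), ← projM_trace S hS]
  exact Finset.single_le_sum (f := fun i => projM S i i)
    (fun i _ => projM_diag_nonneg S i) (Finset.mem_univ i)

theorem gm_perm {m n : ℕ} (σ : Equiv.Perm (Fin n)) :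
    MeasurePreserving (fun S : Matrix (Fin m) (Fin n) ℝ => S.submatrix id σ)
      (stdGaussMatrix m n) (stdGaussMatrix m n) := by
  have := measurePreserving_arrowCongr' (fun _ : Fin n => ProbabilityTheory.gaussianReal 0 1)
    (fun _ : Fin n => ProbabilityTheory.gaussianReal 0 1) σ.symm (MeasurableEquiv.refl ℝ)
    (fun _ => MeasurePreserving.id _)
  exact measurePreserving_pi
    (fun _ : Fin m => Measure.pi fun _ : Fin n => ProbabilityTheory.gaussianReal 0 1)
    (fun _ : Fin m => Measure.pi fun _ : Fin n => ProbabilityTheory.gaussianReal 0 1)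
    (f := fun _ (r : Fin n → ℝ) => fun b => r (σ b)) (fun _ => this)

theorem gm_sign {m n : ℕ} (i : Fin n) :
    MeasurePreserving (fun S : Matrix (Fin m) (Fin n) ℝ =>
        S * Matrix.diagonal (fun k => if k = i then (-1 : ℝ) else 1))
      (stdGaussMatrix m n) (stdGaussMatrix m n) := by
  have h := measurePreserving_pi
    (fun _ : Fin m => Measure.pi fun _ : Fin n => ProbabilityTheory.gaussianReal 0 1)
    (fun _ : Fin m => Measure.pi fun _ : Fin n => ProbabilityTheory.gaussianReal 0 1)
    (f := fun _ r => fun b => r b * (if b = i then (-1 : ℝ) else 1)) (fun _ =>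
      measurePreserving_pi _ _ (f := fun b x => x * (if b = i then (-1 : ℝ) else 1)) fun b => by
        by_cases hb : b = i
        · simp only [hb, if_true, mul_neg, mul_one]
          exact ⟨measurable_neg, by simpa using ProbabilityTheory.gaussianReal_map_neg (μ := 0) (v := 1)⟩
        · simp only [hb, if_false, mul_one]
          exact MeasurePreserving.id _)
  have e : (fun S : Matrix (Fin m) (Fin n) ℝ =>
        S * Matrix.diagonal (fun k => if k = i then (-1 : ℝ) else 1)) =
      fun S => (fun a b => S a b * (if b = i then (-1 : ℝ) else 1)) := by
    funext S a b
    exact Matrix.mul_diagonal _ _ _ _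
  rw [e]
  exact h

theorem gm_integral_comp {m n : ℕ} {f : Matrix (Fin m) (Fin n) ℝ → Matrix (Fin m) (Fin n) ℝ}
    (hf : MeasurePreserving f (stdGaussMatrix m n) (stdGaussMatrix m n)) (i j : Fin n) :
    ∫ S, projM (f S) i j ∂stdGaussMatrix m n = ∫ S, projM S i j ∂stdGaussMatrix m n := by
  conv_rhs => rw [← hf.map_eq]
  rw [integral_map hf.measurable.aemeasurable (projM_meas i j).aestronglyMeasurable]

theorem projM_perm {m n : ℕ} (σ : Equiv.Perm (Fin n)) (S : Matrix (Fin m) (Fin n) ℝ) :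
    projM (S.submatrix id σ) = (projM S).submatrix σ σ := by
  have : S.submatrix id σ * (S.submatrix id σ)ᵀ = S * Sᵀ := by
    rw [Matrix.transpose_submatrix, Matrix.submatrix_mul_equiv, Matrix.submatrix_id_id]
  rw [projM, this]
  ext a b
  simp [projM, Matrix.mul_apply]

theorem projM_sign {m n : ℕ} (i : Fin n) (S : Matrix (Fin m) (Fin n) ℝ) :
    projM (S * Matrix.diagonal (fun k => if k = i then (-1 : ℝ) else 1)) =
      Matrix.diagonal (fun k => if k = i then (-1 : ℝ) else 1) * projM S *
        Matrix.diagonal (fun k => if k = i then (-1 : ℝ) else 1) := by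
  set D := Matrix.diagonal (fun k => if k = i then (-1 : ℝ) else 1) with hD
  have hDD : D * D = 1 := by
    rw [hD, Matrix.diagonal_mul_diagonal, ← Matrix.diagonal_one]
    congr 1
    funext k
    split_ifs <;> simp
  have hT : Dᵀ = D := Matrix.diagonal_transpose _
  have : (S * D) * (S * D)ᵀ = S * Sᵀ := by
    rw [Matrix.transpose_mul, hT, Matrix.mul_assoc, ← Matrix.mul_assoc D, hDD, Matrix.one_mul]
  rw [projM, this, Matrix.transpose_mul, hT, projM]
  simp only [Matrix.mul_assoc]

/-- for a Gaussian sketch with m ≤ n, S Sᵀ is a.s. invertible and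
E[Sᵀ (S Sᵀ)⁻¹ S] = (m/n)·Iₙ, entrywise. -/
theorem gaussian_sketch_projection_expectation
    {m n : ℕ} (hm : 0 < m) (hn : 0 < n) (hmn : m ≤ n) :
    (∀ᵐ S ∂stdGaussMatrix m n, IsUnit (S * Sᵀ)) ∧
      ∀ i j : Fin n,
        ∫ S, (Sᵀ * (S * Sᵀ)⁻¹ * S) i j ∂stdGaussMatrix m n
          = if i = j then (m : ℝ) / (n : ℝ) else 0 := by
  refine ⟨?_, fun i j => ?_⟩
  · filter_upwards [gm_ae_det hmn] with S hS
    exact (Matrix.isUnit_iff_isUnit_det _).2 (isUnit_iff_ne_zero.2 hS)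
  · change ∫ S, projM S i j ∂stdGaussMatrix m n = _
    split_ifs with hij
    · subst hij
      have heq : ∀ k, ∫ S, projM S k k ∂stdGaussMatrix m n
          = ∫ S, projM S i i ∂stdGaussMatrix m n := by
        intro k
        have := gm_integral_comp (gm_perm (m := m) (Equiv.swap i k)) i i
        simpa [projM_perm] using this
      have hsum : ∑ k, ∫ S, projM S k k ∂stdGaussMatrix m n = m := by
        rw [← integral_finsetSum _ (fun k _ => gm_integrable hmn k)]
        rw [integral_congr_ae (g := fun _ => (m : ℝ))
          ((gm_ae_det hmn).mono fun S hS => projM_trace S hS)]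
        simp
      rw [Finset.sum_congr rfl fun k _ => heq k] at hsum
      simp only [Finset.sum_const, Finset.card_univ, Fintype.card_fin, nsmul_eq_mul] at hsum
      have : (n : ℝ) ≠ 0 := by exact_mod_cast hn.ne'
      field_simp
      linarith
    · have := gm_integral_comp (gm_sign (m := m) i) i j
      simp only [projM_sign, Matrix.mul_diagonal, Matrix.diagonal_mul, if_true,
        if_neg (Ne.symm hij), mul_one, neg_mul, one_mul, integral_neg] at this
      linarith
end

section
/- Let C ⊆ ℝ^d contain x*, let A ∈ ℝ^{n×d}, σ > 0, and let K* = {(t/√n)·A(x − x*) : t ∈ [0,1], x ∈ C}. Suppose ε > 0 satisfies the critical inequality σ·W_ε(K*) ≤ ε²·√n, and let w ↦ x_LS(w) be a measurable map such that for each w ∈ ℝⁿ, x_LS(w) ∈ C minimizes x ↦ ‖(A x* + w) − A x‖₂² over C, where w has i.i.d. N(0,σ²) coordinates. Then for every t ≥ ε, P_w[(1/n)‖A(x_LS(w) − x*)‖₂² ≥ 16·t·ε] ≤ exp(−n·t·ε/(2σ²)). -/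
open MeasureTheory Matrix

/-- Standard Gaussian product measure on ℝⁿ (i.i.d. N(0,1) coordinates). -/
noncomputable def stdGaussPi (n : ℕ) : Measure (Fin n → ℝ) :=
  Measure.pi fun _ => ProbabilityTheory.gaussianReal 0 1

/-- Product Gaussian measure on ℝⁿ with i.i.d. N(0,σ²) coordinates. -/
noncomputable def gaussPi (n : ℕ) (σ : ℝ) : Measure (Fin n → ℝ) :=
  Measure.pi fun _ => ProbabilityTheory.gaussianReal 0 (Real.toNNReal (σ ^ 2))

/-- Localized Gaussian width W_ε(Θ) = E_g sup{|⟨g, θ⟩| : θ ∈ Θ, ‖θ‖₂ ≤ ε}. -/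
noncomputable def gaussWidth {n : ℕ} (ε : ℝ) (Θ : Set (Fin n → ℝ)) : ℝ :=
  ∫ g, sSup ((fun θ => |g ⬝ᵥ θ|) '' {θ ∈ Θ | l2norm θ ≤ ε}) ∂stdGaussPi n

/-- The star-shaped set K* = {(t/√n)·A(x − x*) : t ∈ [0,1], x ∈ C}. -/
def Kstar {n d : ℕ} (A : Matrix (Fin n) (Fin d) ℝ) (C : Set (Fin d → ℝ))
    (xstar : Fin d → ℝ) : Set (Fin n → ℝ) :=
  {v | ∃ t ∈ Set.Icc (0 : ℝ) 1, ∃ x ∈ C, v = (t / Real.sqrt n) • A.mulVec (x - xstar)}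


namespace CLS
open ProbabilityTheory Real
open scoped RealInnerProductSpace NNReal ENNReal

section conc

variable {E : Type*} [NormedAddCommGroup E] [InnerProductSpace ℝ E] [FiniteDimensional ℝ E]
  [MeasurableSpace E] [BorelSpace E]

lemma integrable_exp_norm (c : ℝ) :
    Integrable (fun x : E => rexp (c * ‖x‖)) (stdGaussian E) := by
  obtain ⟨C, hC, hint⟩ := IsGaussian.exists_integrable_exp_sq (stdGaussian E)
  refine (hint.const_mul (rexp (c ^ 2 / (4 * C)))).mono' (by fun_prop) ?_
  refine Filter.Eventually.of_forall fun x => ?_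
  rw [Real.norm_eq_abs, abs_of_pos (exp_pos _), ← Real.exp_add]
  apply Real.exp_le_exp.2
  have : c ^ 2 / (4 * C) + C * ‖x‖ ^ 2 - c * ‖x‖ = C * (‖x‖ - c / (2 * C)) ^ 2 := by
    field_simp; ring
  have h2 : 0 ≤ C * (‖x‖ - c / (2 * C)) ^ 2 := by positivity
  linarith

lemma integrable_of_growth {k : E → ℝ} (hk : Continuous k) {D c : ℝ}
    (hb : ∀ x, |k x| ≤ D * rexp (c * ‖x‖)) : Integrable k (stdGaussian E) :=
  ((integrable_exp_norm c).const_mul D).mono' hk.aestronglyMeasurable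
    (Filter.Eventually.of_forall hb)

lemma stdGaussian_eq_withDensity :
    ∃ Z : ℝ, 0 < Z ∧ stdGaussian E =
      (volume : Measure E).withDensity (fun x => ENNReal.ofReal (Z * rexp (-(1/2) * ‖x‖ ^ 2))) := by
  set I : ℝ := (π / (1/2)) ^ (Module.finrank ℝ E / 2 : ℝ) with hI
  have hIpos : 0 < I := by positivity
  refine ⟨I⁻¹, by positivity, ?_⟩
  have hint : Integrable (fun x : E => I⁻¹ * rexp (-(1/2) * ‖x‖ ^ 2)) := by
    have h := GaussianFourier.integrable_cexp_neg_mul_sq_norm_add (V := E) (b := 1/2) (by norm_num) 0 0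
    refine (h.norm.const_mul I⁻¹).congr (Filter.Eventually.of_forall fun x => ?_)
    simp only [Complex.norm_exp]
    congr 2
    simp [← Complex.ofReal_pow]
  have : IsFiniteMeasure ((volume : Measure E).withDensity
      (fun x => ENNReal.ofReal (I⁻¹ * rexp (-(1/2) * ‖x‖ ^ 2)))) :=
    isFiniteMeasure_withDensity_ofReal hint.2
  apply Measure.ext_of_charFun
  ext t
  rw [charFun_stdGaussian, charFun_apply, integral_withDensity_eq_integral_toReal_smul (by fun_prop)
    (Filter.Eventually.of_forall fun _ => ENNReal.ofReal_lt_top)]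
  have h := GaussianFourier.integral_cexp_neg_mul_sq_norm_add (V := E) (b := 1/2) (by norm_num)
    Complex.I t
  have h2 : ((π : ℂ) / (1/2)) ^ (Module.finrank ℝ E / 2 : ℂ) = (I : ℂ) := by
    rw [hI, Complex.ofReal_cpow (by positivity)]; push_cast; rfl
  rw [h2] at h
  have h3 : ∀ x : E, (ENNReal.ofReal (I⁻¹ * rexp (-(1/2) * ‖x‖ ^ 2))).toReal •
      Complex.exp (⟪x, t⟫ * Complex.I) =
      (I : ℂ)⁻¹ * Complex.exp (-(1/2) * ‖x‖ ^ 2 + Complex.I * ⟪t, x⟫) := by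
    intro x
    rw [ENNReal.toReal_ofReal (by positivity), Complex.real_smul, Complex.exp_add, real_inner_comm]
    push_cast
    rw [mul_comm Complex.I]; ring
  simp_rw [h3]
  rw [integral_const_mul, h, ← mul_assoc, inv_mul_cancel₀ (by exact_mod_cast hIpos.ne'), one_mul]
  congr 1
  simp; ring

lemma stein {k : E → ℝ} (hk : ContDiff ℝ 1 k) {D c : ℝ}
    (hb : ∀ x, |k x| ≤ D * rexp (c * ‖x‖)) (hb' : ∀ x, ‖fderiv ℝ k x‖ ≤ D * rexp (c * ‖x‖))
    (v : E) :
    ∫ x, k x * ⟪v, x⟫ ∂(stdGaussian E) = ∫ x, fderiv ℝ k x v ∂(stdGaussian E) := by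
  have hD : 0 ≤ D := by
    have := (abs_nonneg _).trans (hb 0)
    exact nonneg_of_mul_nonneg_left this (exp_pos _)
  have hkc := hk.continuous
  have hkc' : Continuous (fun x => fderiv ℝ k x v) :=
    (hk.continuous_fderiv (by norm_num)).clm_apply continuous_const
  have i1 : Integrable k (stdGaussian E) := integrable_of_growth hkc hb
  have i2 : Integrable (fun x => fderiv ℝ k x v) (stdGaussian E) := by
    refine integrable_of_growth (D := D * ‖v‖) (c := c) hkc' fun x => ?_
    calc |fderiv ℝ k x v| ≤ ‖fderiv ℝ k x‖ * ‖v‖ := (fderiv ℝ k x).le_opNorm v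
      _ ≤ (D * rexp (c * ‖x‖)) * ‖v‖ := by gcongr; exact hb' x
      _ = _ := by ring
  have i3 : Integrable (fun x => k x * ⟪v, x⟫) (stdGaussian E) := by
    refine integrable_of_growth (D := D * ‖v‖) (c := c + 1) (by fun_prop) fun x => ?_
    rw [abs_mul]
    calc |k x| * |⟪v, x⟫| ≤ (D * rexp (c * ‖x‖)) * (‖v‖ * rexp ‖x‖) := by
          gcongr
          · exact hb x
          · refine (abs_real_inner_le_norm v x).trans ?_
            gcongr
            linarith [add_one_le_exp ‖x‖]
      _ = _ := by rw [add_mul, exp_add, one_mul]; ring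
  obtain ⟨Z, hZ, hμ⟩ := stdGaussian_eq_withDensity (E := E)
  set ρ : E → ℝ := fun x => Z * rexp (-(1/2) * ‖x‖ ^ 2) with hρ
  have hρpos : ∀ x, 0 < ρ x := fun x => by positivity
  have hm : Measurable (fun x => ENNReal.ofReal (ρ x)) := by fun_prop
  have hfin : ∀ᵐ x ∂(volume : Measure E), ENNReal.ofReal (ρ x) < ∞ :=
    Filter.Eventually.of_forall fun _ => ENNReal.ofReal_lt_top
  have hderiv : ∀ x, HasFDerivAt ρ ((-(ρ x)) • (innerSL ℝ x)) x := by
    intro x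
    have h1 := (hasStrictFDerivAt_norm_sq x).hasFDerivAt
    have h2 := ((h1.const_mul (-(1/2))).exp).const_mul Z
    refine h2.congr_fderiv ?_
    ext y
    simp [hρ]
    ring
  rw [hμ] at i1 i2 i3 ⊢
  rw [integrable_withDensity_iff_integrable_smul' hm hfin] at i1 i2 i3
  rw [integral_withDensity_eq_integral_toReal_smul hm hfin,
    integral_withDensity_eq_integral_toReal_smul hm hfin]
  simp only [ENNReal.toReal_ofReal (hρpos _).le, smul_eq_mul] at i1 i2 i3 ⊢
  have e : ∀ x, fderiv ℝ ρ x v = - (ρ x * ⟪v, x⟫) := by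
    intro x
    rw [(hderiv x).fderiv]; simp [real_inner_comm]
  have key := integral_mul_fderiv_eq_neg_fderiv_mul_of_integrable (μ := (volume : Measure E))
    (f := k) (g := ρ) (v := v) (by simpa only [mul_comm] using i2)
    (by
      refine i3.neg.congr (Filter.Eventually.of_forall fun x => ?_)
      simp only [Pi.neg_apply, e]; ring)
    (by simpa only [mul_comm] using i1) (fun x _ => hk.differentiable (by norm_num) x)
    (fun x _ => (hderiv x).differentiableAt)
  simp only [e] at key
  rw [← neg_inj, ← integral_neg]
  calc _ = ∫ x, k x * -(ρ x * ⟪v, x⟫) := by congr 1; ext x; ring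
    _ = _ := by rw [key]; congr 2; ext x; ring

lemma lip_growth {f : E → ℝ} {K : ℝ≥0} (hL : LipschitzWith K f) {l : ℝ} (hl : 0 ≤ l) (x : E) :
    rexp (l * f x) ≤ rexp (l * |f 0|) * rexp (l * K * ‖x‖) := by
  rw [← exp_add]
  apply exp_le_exp.2
  have h1 : |f x - f 0| ≤ K * ‖x‖ := by simpa [dist_eq_norm] using hL.dist_le_mul x 0
  have h2 : f x ≤ |f 0| + K * ‖x‖ := by
    have := le_abs_self (f x - f 0)
    have := le_abs_self (f 0)
    linarith
  calc l * f x ≤ l * (|f 0| + K * ‖x‖) := by gcongr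
    _ = _ := by ring

lemma stein_bound {f : E → ℝ} (hf : ContDiff ℝ 1 f) {K : ℝ≥0} (hL : LipschitzWith K f)
    {l : ℝ} (hl : 0 ≤ l) (a : E) {s : ℝ} (hs : 0 ≤ s) (φ : E →L[ℝ] ℝ) (hφ : ‖φ‖ ≤ K) :
    |∫ v, rexp (l * f (a - s • v)) * φ v ∂(stdGaussian E)| ≤
      ∫ v, l * K ^ 2 * s * rexp (l * f (a - s • v)) ∂(stdGaussian E) := by
  set k : E → ℝ := fun v => rexp (l * f (a - s • v)) with hk
  have hkC : ContDiff ℝ 1 k := by rw [hk]; fun_prop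
  have hfd : Differentiable ℝ f := hf.differentiable (by norm_num)
  have hd : ∀ v, HasFDerivAt k (k v • (l • ((fderiv ℝ f (a - s • v)).comp
      (-(s • ContinuousLinearMap.id ℝ E))))) v := by
    intro v
    have h1 : HasFDerivAt (fun v : E => a - s • v) (-(s • ContinuousLinearMap.id ℝ E)) v :=
      ((hasFDerivAt_id v).const_smul s).const_sub a
    have h2 := ((hfd (a - s • v)).hasFDerivAt.comp v h1).const_mul l
    exact h2.exp
  have hnorm : ∀ v, ‖fderiv ℝ k v‖ ≤ (l * K * s) * k v := by
    intro v
    have hkv : 0 < k v := exp_pos _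
    rw [(hd v).fderiv]
    refine ContinuousLinearMap.opNorm_le_bound _ (by positivity) fun y => ?_
    have h3 : |fderiv ℝ f (a - s • v) y| ≤ K * ‖y‖ :=
      (fderiv ℝ f (a - s • v)).le_of_opNorm_le (norm_fderiv_le_of_lipschitz ℝ hL) y
    simp only [_root_.smul_apply, ContinuousLinearMap.comp_apply,
      _root_.neg_apply, ContinuousLinearMap.id_apply, map_neg, map_smul, smul_eq_mul,
      norm_mul, norm_neg, Real.norm_eq_abs, abs_of_pos hkv, abs_of_nonneg hl, abs_of_nonneg hs]
    calc k v * (l * (s * |fderiv ℝ f (a - s • v) y|)) ≤ k v * (l * (s * (K * ‖y‖))) := by gcongr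
      _ = _ := by ring
  have hg : ∀ v, k v ≤ rexp (l * |f 0| + l * K * ‖a‖) * rexp (l * K * s * ‖v‖) := by
    intro v
    refine (lip_growth hL hl _).trans ?_
    rw [← exp_add, ← exp_add]
    apply exp_le_exp.2
    have : ‖a - s • v‖ ≤ ‖a‖ + s * ‖v‖ := by
      refine (norm_sub_le _ _).trans ?_
      rw [norm_smul, Real.norm_eq_abs, abs_of_nonneg hs]
    calc l * |f 0| + l * K * ‖a - s • v‖ ≤ l * |f 0| + l * K * (‖a‖ + s * ‖v‖) := by gcongr
      _ = _ := by ring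
  set D := rexp (l * |f 0| + l * K * ‖a‖)
  have hDpos : 0 < D := exp_pos _
  have hg1 : ∀ v, |k v| ≤ (1 + l * K * s) * D * rexp (l * K * s * ‖v‖) := by
    intro v
    rw [abs_of_pos (exp_pos _ : 0 < k v)]
    refine (hg v).trans ?_
    rw [mul_assoc (1 + l * K * s)]
    refine le_mul_of_one_le_left (mul_pos hDpos (exp_pos _)).le ?_
    have : 0 ≤ l * K * s := by positivity
    linarith
  have hg2 : ∀ v, ‖fderiv ℝ k v‖ ≤ (1 + l * K * s) * D * rexp (l * K * s * ‖v‖) := by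
    intro v
    refine (hnorm v).trans ?_
    rw [mul_assoc (1 + l * K * s)]
    have hkv : 0 < k v := exp_pos _
    have : 0 ≤ l * K * s := by positivity
    gcongr
    · linarith
    · exact hg v
  obtain ⟨w, hw⟩ := (InnerProductSpace.toDual ℝ E).surjective φ
  have hφw : ∀ v, φ v = ⟪w, v⟫ := by intro v; rw [← hw]; simp
  have hwn : ‖w‖ ≤ K := by rw [← hw] at hφ; simpa using hφ
  simp_rw [hφw]
  rw [stein hkC hg1 hg2 w]
  have hki : Integrable k (stdGaussian E) := integrable_of_growth hkC.continuous hg1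
  refine norm_integral_le_of_norm_le (f := fun x => fderiv ℝ k x w)
    (hki.const_mul (l * K ^ 2 * s))
    (Filter.Eventually.of_forall fun v => ?_)
  have hkv : 0 < k v := exp_pos _
  calc ‖fderiv ℝ k v w‖ ≤ ‖fderiv ℝ k v‖ * ‖w‖ := (fderiv ℝ k v).le_opNorm w
    _ ≤ ((l * K * s) * k v) * K := by
      gcongr
      exact hnorm v
    _ = _ := by ring

lemma cov_bound {f : E → ℝ} (hf : ContDiff ℝ 1 f) {K : ℝ≥0} (hL : LipschitzWith K f)
    {l : ℝ} (hl : 0 ≤ l) :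
    ∫ x, f x * rexp (l * f x) ∂(stdGaussian E) ≤
      (∫ x, f x ∂(stdGaussian E) + l * K ^ 2) * ∫ x, rexp (l * f x) ∂(stdGaussian E) := by
  set μ := stdGaussian E with hμ
  set h : E → ℝ := fun x => rexp (l * f x) with hh
  have hfc : Continuous f := hf.continuous
  have hfd : Differentiable ℝ f := hf.differentiable (by norm_num)
  have hf'c : Continuous (fderiv ℝ f) := hf.continuous_fderiv (by norm_num)
  have hhc : Continuous h := by rw [hh]; fun_prop
  have hhpos : ∀ x, 0 < h x := fun x => exp_pos _
  have hK : ∀ x, ‖fderiv ℝ f x‖ ≤ K := fun x => norm_fderiv_le_of_lipschitz ℝ hL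
  have hhint : Integrable h μ := integrable_of_growth hhc
    (fun x => by rw [abs_of_pos (hhpos x)]; exact lip_growth hL hl x)
  have hfgrow : ∀ x, |f x| ≤ |f 0| + K * ‖x‖ := by
    intro x
    have h1 : |f x - f 0| ≤ K * ‖x‖ := by simpa [dist_eq_norm] using hL.dist_le_mul x 0
    have := abs_sub_abs_le_abs_sub (f x) (f 0)
    linarith
  have hfgrow' : ∀ x, |f x| ≤ (|f 0| + K) * rexp (1 * ‖x‖) := by
    intro x
    refine (hfgrow x).trans ?_
    have h1 := add_one_le_exp ‖x‖
    have h2 : 1 ≤ rexp ‖x‖ := one_le_exp (norm_nonneg _)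
    rw [add_mul, one_mul]
    have := mul_le_mul_of_nonneg_left h2 (abs_nonneg (f 0))
    have := mul_le_mul_of_nonneg_left (by linarith : ‖x‖ ≤ rexp ‖x‖) K.2
    simp only [NNReal.val_eq_coe] at this
    linarith
  have hfint : Integrable f μ := integrable_of_growth hfc hfgrow'
  have hfhint : Integrable (fun x => f x * h x) μ := by
    refine integrable_of_growth (D := (|f 0| + K) * rexp (l * |f 0|)) (c := 1 + l * K)
      (by fun_prop) fun x => ?_
    rw [abs_mul, abs_of_pos (hhpos x)]
    calc _ ≤ ((|f 0| + K) * rexp (1 * ‖x‖)) * (rexp (l * |f 0|) * rexp (l * K * ‖x‖)) := by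
          gcongr
          · exact hfgrow' x
          · exact lip_growth hL hl x
      _ = _ := by rw [add_mul (1:ℝ), exp_add]; ring
  set P := μ.prod μ with hP
  -- dominating function
  have hBint : Integrable (fun p : E × E => h p.1 * (K * (‖p.1‖ + ‖p.2‖))) P := by
    have i1 : Integrable (fun x : E => h x * rexp (1 * ‖x‖)) μ := by
      refine integrable_of_growth (D := rexp (l * |f 0|)) (c := l * K + 1) (by fun_prop) fun x => ?_
      rw [abs_of_pos (by have := hhpos x; positivity)]
      calc _ ≤ (rexp (l * |f 0|) * rexp (l * K * ‖x‖)) * rexp (1 * ‖x‖) := by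
            gcongr
            exact lip_growth hL hl x
        _ = _ := by rw [add_mul _ (1:ℝ), exp_add]; ring
    have i2 := (i1.mul_prod (integrable_exp_norm (E := E) 1)).const_mul (K : ℝ)
    refine i2.mono' (by fun_prop) (Filter.Eventually.of_forall fun p => ?_)
    have hp := hhpos p.1
    rw [Real.norm_eq_abs, abs_of_nonneg (by positivity)]
    have : ‖p.1‖ + ‖p.2‖ ≤ rexp (1 * ‖p.1‖) * rexp (1 * ‖p.2‖) := by
      rw [← exp_add]
      have := add_one_le_exp (1 * ‖p.1‖ + 1 * ‖p.2‖)
      linarith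
    calc _ ≤ h p.1 * (K * (rexp (1 * ‖p.1‖) * rexp (1 * ‖p.2‖))) := by gcongr
      _ = _ := by ring
  let G : ℝ → E × E → ℝ := fun θ p =>
    h p.1 * fderiv ℝ f (cos θ • p.1 + sin θ • p.2) (-sin θ • p.1 + cos θ • p.2)
  have hGc : Continuous (Function.uncurry G) := by
    refine Continuous.mul (by fun_prop) ?_
    refine Continuous.clm_apply (hf'c.comp ?_) ?_ <;> fun_prop
  have hGb : ∀ θ p, |G θ p| ≤ h p.1 * (K * (‖p.1‖ + ‖p.2‖)) := by
    intro θ p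
    have hp := hhpos p.1
    simp only [G]
    rw [abs_mul, abs_of_pos hp]
    gcongr
    refine (ContinuousLinearMap.le_of_opNorm_le _ (hK _) _).trans ?_
    gcongr
    refine (norm_add_le _ _).trans ?_
    rw [norm_smul, norm_smul]
    gcongr
    · exact mul_le_of_le_one_left (norm_nonneg _) (by simpa using abs_sin_le_one θ)
    · exact mul_le_of_le_one_left (norm_nonneg _) (by simpa using abs_cos_le_one θ)
  have hGint : ∀ θ, Integrable (G θ) P := fun θ =>
    hBint.mono' (hGc.comp (by fun_prop : Continuous fun p : E × E => (θ, p))).aestronglyMeasurable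
      (Filter.Eventually.of_forall (hGb θ))
  have hrot : ∀ θ, MeasurePreserving
      (fun p : E × E => (cos θ • p.1 + sin θ • p.2, -sin θ • p.1 + cos θ • p.2)) P P := by
    intro θ
    refine ⟨by fun_prop, ?_⟩
    have := IsGaussian.map_rotation_eq_self (μ := μ) (by simp [hμ]) θ
    exact this
  have hA : ∀ θ ∈ Set.Icc 0 (π / 2), |∫ p, G θ p ∂P| ≤ (l * K ^ 2 * ∫ x, h x ∂μ) * sin θ := by
    intro θ hθ
    have hs : 0 ≤ sin θ := sin_nonneg_of_nonneg_of_le_pi hθ.1 (by linarith [hθ.2, pi_pos])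
    let F : E × E → ℝ := fun q => h (cos θ • q.1 - sin θ • q.2) * fderiv ℝ f q.1 q.2
    let H : E × E → ℝ := fun q => h (cos θ • q.1 - sin θ • q.2)
    have hFc : Continuous F := by
      refine Continuous.mul (by fun_prop) ?_
      exact Continuous.clm_apply (hf'c.comp (by fun_prop)) (by fun_prop)
    have hHc : Continuous H := by simp only [H]; fun_prop
    have hback : ∀ p : E × E, cos θ • (cos θ • p.1 + sin θ • p.2)
        - sin θ • (-sin θ • p.1 + cos θ • p.2) = p.1 := by
      intro p
      have : cos θ • (cos θ • p.1 + sin θ • p.2) - sin θ • (-sin θ • p.1 + cos θ • p.2)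
        = (sin θ ^ 2 + cos θ ^ 2) • p.1 := by module
      rw [this, sin_sq_add_cos_sq, one_smul]
    have e1 : G θ = F ∘ (fun p : E × E =>
        (cos θ • p.1 + sin θ • p.2, -sin θ • p.1 + cos θ • p.2)) := by
      ext p; simp only [G, F, Function.comp, hback]
    have e2 : (fun p : E × E => h p.1) = H ∘ (fun p : E × E =>
        (cos θ • p.1 + sin θ • p.2, -sin θ • p.1 + cos θ • p.2)) := by
      ext p; simp only [H, Function.comp, hback]
    have hFi : Integrable F P := by
      rw [← (hrot θ).integrable_comp hFc.aestronglyMeasurable, ← e1]; exact hGint θ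
    have hh1 : Integrable (fun p : E × E => h p.1) P := hhint.comp_fst μ
    have hHi : Integrable H P := by
      rw [← (hrot θ).integrable_comp hHc.aestronglyMeasurable, ← e2]; exact hh1
    have hI1 : ∫ p, G θ p ∂P = ∫ q, F q ∂P := by
      conv_rhs => rw [← (hrot θ).map_eq]
      rw [integral_map (hrot θ).measurable.aemeasurable hFc.aestronglyMeasurable, e1]
      rfl
    have hI2 : ∫ p : E × E, h p.1 ∂P = ∫ q, H q ∂P := by
      conv_rhs => rw [← (hrot θ).map_eq]
      rw [integral_map (hrot θ).measurable.aemeasurable hHc.aestronglyMeasurable, e2]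
      rfl
    have hI3 : ∫ p : E × E, h p.1 ∂P = ∫ x, h x ∂μ := by
      rw [hP, integral_fun_fst]; simp
    rw [hI1, hP, integral_prod _ hFi]
    have hHi' := hHi.const_mul (l * K ^ 2 * sin θ)
    calc |∫ u, ∫ v, F (u, v) ∂μ ∂μ| ≤ ∫ u, ∫ v, l * K ^ 2 * sin θ * H (u, v) ∂μ ∂μ := by
          refine norm_integral_le_of_norm_le (f := fun u => ∫ v, F (u, v) ∂μ)
            hHi'.integral_prod_left (Filter.Eventually.of_forall fun u => ?_)
          exact stein_bound hf hL hl (cos θ • u) hs (fderiv ℝ f u) (hK u)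
      _ = ∫ q, l * K ^ 2 * sin θ * H q ∂P := (integral_prod _ hHi').symm
      _ = _ := by rw [integral_const_mul, ← hI2, hI3]; ring
  have hB : ∫ p : E × E, h p.1 * (f p.2 - f p.1) ∂P = ∫ θ in (0:ℝ)..(π/2), ∫ p, G θ p ∂P := by
    rw [intervalIntegral_integral_swap]
    · congr 1
      ext p
      have hder : ∀ θ : ℝ, HasDerivAt (fun θ => h p.1 * f (cos θ • p.1 + sin θ • p.2)) (G θ p) θ := by
        intro θ
        have h1 : HasDerivAt (fun θ : ℝ => cos θ • p.1 + sin θ • p.2)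
            (-sin θ • p.1 + cos θ • p.2) θ :=
          ((hasDerivAt_cos θ).smul_const p.1).add ((hasDerivAt_sin θ).smul_const p.2)
        exact ((hfd _).hasFDerivAt.comp_hasDerivAt θ h1).const_mul _
      rw [intervalIntegral.integral_eq_sub_of_hasDerivAt (fun θ _ => hder θ)]
      · simp; ring
      · exact (hGc.comp (by fun_prop : Continuous fun θ : ℝ => (θ, p))).intervalIntegrable _ _
    · have : IsFiniteMeasure ((volume : Measure ℝ).restrict (Set.uIoc 0 (π/2))) :=
        ⟨by rw [Measure.restrict_apply_univ, Set.uIoc]; exact measure_Ioc_lt_top⟩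
      have hb2 : Integrable (fun z : ℝ × (E × E) => h z.2.1 * (K * (‖z.2.1‖ + ‖z.2.2‖)))
          ((volume.restrict (Set.uIoc 0 (π/2))).prod P) := hBint.comp_snd _
      exact hb2.mono' hGc.aestronglyMeasurable (Filter.Eventually.of_forall fun z => hGb z.1 z.2)
  have hC : |∫ θ in (0:ℝ)..(π/2), ∫ p, G θ p ∂P| ≤ l * K ^ 2 * ∫ x, h x ∂μ := by
    have hpi : (0:ℝ) ≤ π / 2 := by positivity
    have := intervalIntegral.norm_integral_le_of_norm_le (f := fun θ => ∫ p, G θ p ∂P)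
      (g := fun θ => (l * K ^ 2 * ∫ x, h x ∂μ) * sin θ) (μ := volume) hpi
      (Filter.Eventually.of_forall fun θ hθ => hA θ ⟨hθ.1.le, hθ.2⟩)
      ((by fun_prop : Continuous fun θ => (l * K ^ 2 * ∫ x, h x ∂μ) * sin θ).intervalIntegrable _ _)
    rw [intervalIntegral.integral_const_mul, integral_sin] at this
    simpa using this
  have hD : ∫ p : E × E, h p.1 * (f p.2 - f p.1) ∂P =
      (∫ x, h x ∂μ) * (∫ x, f x ∂μ) - ∫ x, f x * h x ∂μ := by
    have : ∀ p : E × E, h p.1 * (f p.2 - f p.1) = h p.1 * f p.2 - f p.1 * h p.1 := by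
      intro p; ring
    simp_rw [this]
    rw [integral_sub (hhint.mul_prod hfint) (hfhint.comp_fst μ), integral_prod_mul,
      integral_fun_fst (fun x => f x * h x)]
    simp
  rw [← hB, hD] at hC
  have := neg_abs_le ((∫ x, h x ∂μ) * (∫ x, f x ∂μ) - ∫ x, f x * h x ∂μ)
  linarith

lemma mgf_smooth {f : E → ℝ} (hf : ContDiff ℝ 1 f) {K : ℝ≥0} (hL : LipschitzWith K f)
    {l : ℝ} (hl : 0 ≤ l) :
    ∫ x, rexp (l * f x) ∂(stdGaussian E) ≤
      rexp (l * ∫ x, f x ∂(stdGaussian E) + l ^ 2 * K ^ 2 / 2) := by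
  set μ := stdGaussian E with hμ
  set m := ∫ x, f x ∂μ with hm
  have hfc := hL.continuous
  have hset : integrableExpSet f μ = Set.univ := by
    ext t
    simp only [Set.mem_univ, iff_true]
    change Integrable (fun x => rexp (t * f x)) μ
    rcases le_total 0 t with ht | ht
    · exact integrable_of_growth (by fun_prop)
        (fun x => by rw [abs_of_pos (exp_pos _)]; exact lip_growth hL ht x)
    · have hL' : LipschitzWith K (fun x => - f x) := hL.neg
      refine integrable_of_growth (by fun_prop)
        (fun x => ?_) (D := rexp (-t * |-f 0|)) (c := -t * K)
      rw [abs_of_pos (exp_pos _)]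
      have := lip_growth hL' (by linarith : 0 ≤ -t) x
      simpa only [neg_mul_neg] using this
  have hM : ∀ t, HasDerivAt (mgf f μ) (∫ x, f x * rexp (t * f x) ∂μ) t := fun t =>
    hasDerivAt_mgf (by rw [hset]; simp)
  let ψ : ℝ → ℝ := fun t => rexp (-(t * m + t ^ 2 * K ^ 2 / 2)) * mgf f μ t
  have hψ : ∀ t, HasDerivAt ψ (rexp (-(t * m + t ^ 2 * K ^ 2 / 2)) *
      ((∫ x, f x * rexp (t * f x) ∂μ) - (m + t * K ^ 2) * mgf f μ t)) t := by
    intro t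
    have h1 : HasDerivAt (fun t : ℝ => -(t * m + t ^ 2 * K ^ 2 / 2)) (-(m + t * K ^ 2)) t := by
      have a := (hasDerivAt_id t).mul_const m
      have b := (((hasDerivAt_id t).pow 2).mul_const ((K:ℝ) ^ 2)).div_const 2
      refine (a.add b).neg.congr_deriv ?_
      simp; ring
    refine (h1.exp.mul (hM t)).congr_deriv ?_
    ring
  have hanti : AntitoneOn ψ (Set.Ici 0) := by
    apply antitoneOn_of_deriv_nonpos (convex_Ici 0)
    · exact fun t _ => (hψ t).continuousAt.continuousWithinAt
    · exact fun t _ => (hψ t).differentiableAt.differentiableWithinAt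
    · intro t ht
      rw [interior_Ici] at ht
      rw [(hψ t).deriv]
      have := cov_bound hf hL (le_of_lt ht : 0 ≤ t)
      refine mul_nonpos_of_nonneg_of_nonpos (exp_pos _).le ?_
      simp only [mgf]
      linarith
  have h0 : ψ l ≤ ψ 0 := hanti (Set.mem_Ici.2 le_rfl) hl hl
  have h1 : ψ 0 = 1 := by simp [ψ]
  rw [h1] at h0
  have h2 : mgf f μ l = rexp (l * m + l ^ 2 * K ^ 2 / 2) * ψ l := by
    simp only [ψ]; rw [← mul_assoc, ← exp_add]; simp
  change mgf f μ l ≤ _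
  rw [h2]
  exact mul_le_of_le_one_right (exp_pos _).le h0

lemma exists_smooth {f : E → ℝ} {K : ℝ≥0} (hL : LipschitzWith K f) {δ : ℝ} (hδ : 0 < δ) :
    ∃ g : E → ℝ, ContDiff ℝ 1 g ∧ LipschitzWith K g ∧ ∀ x, |g x - f x| ≤ K * δ := by
  let φ : ContDiffBump (0 : E) := ⟨δ / 2, δ, by positivity, by linarith⟩
  have hfc := hL.continuous
  refine ⟨convolution (φ.normed volume) f (ContinuousLinearMap.lsmul ℝ ℝ) volume, ?_, ?_, ?_⟩
  · exact φ.hasCompactSupport_normed.contDiff_convolution_left _ φ.contDiff_normed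
      hfc.locallyIntegrable
  · have hi : ∀ x, Integrable (fun t => φ.normed volume t * f (x - t)) := fun x =>
      (φ.continuous_normed.mul (by fun_prop)).integrable_of_hasCompactSupport
        φ.hasCompactSupport_normed.mul_right
    refine LipschitzWith.of_dist_le_mul fun x y => ?_
    simp only [convolution_def, ContinuousLinearMap.lsmul_apply, smul_eq_mul]
    rw [dist_eq_norm, ← integral_sub (hi x) (hi y)]
    calc _ ≤ ∫ t, φ.normed volume t * (K * dist x y) := by
          refine norm_integral_le_of_norm_le (φ.integrable_normed.mul_const _)
            (Filter.Eventually.of_forall fun t => ?_)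
          rw [← mul_sub, norm_mul, Real.norm_of_nonneg (φ.nonneg_normed t)]
          refine mul_le_mul_of_nonneg_left ?_ (φ.nonneg_normed t)
          have := hL.dist_le_mul (x - t) (y - t)
          rwa [dist_sub_right, dist_eq_norm] at this
      _ = _ := by rw [integral_mul_const, φ.integral_normed, one_mul]
  · intro x
    refine φ.dist_normed_convolution_le hfc.aestronglyMeasurable fun y hy => ?_
    refine (hL.dist_le_mul y x).trans ?_
    gcongr
    exact (Metric.mem_ball.1 hy).le

lemma mgf_lip {f : E → ℝ} {K : ℝ≥0} (hL : LipschitzWith K f)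
    {l : ℝ} (hl : 0 ≤ l) :
    ∫ x, rexp (l * f x) ∂(stdGaussian E) ≤
      rexp (l * ∫ x, f x ∂(stdGaussian E) + l ^ 2 * K ^ 2 / 2) := by
  set μ := stdGaussian E with hμ
  have hint : ∀ {g : E → ℝ}, LipschitzWith K g → Integrable (fun x => rexp (l * g x)) μ := by
    intro g hg
    have := hg.continuous
    exact integrable_of_growth (by fun_prop)
        (fun x => by rw [abs_of_pos (exp_pos _)]; exact lip_growth hg hl x)
  have hint1 : ∀ {g : E → ℝ}, LipschitzWith K g → Integrable g μ := by
    intro g hg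
    refine integrable_of_growth (D := |g 0| + K) (c := 1) hg.continuous fun x => ?_
    have h1 : |g x - g 0| ≤ K * ‖x‖ := by simpa [dist_eq_norm] using hg.dist_le_mul x 0
    have h3 := abs_sub_abs_le_abs_sub (g x) (g 0)
    have h2 : 1 ≤ rexp ‖x‖ := one_le_exp (norm_nonneg _)
    have h4 := add_one_le_exp ‖x‖
    rw [add_mul, one_mul]
    have := mul_le_mul_of_nonneg_left h2 (abs_nonneg (g 0))
    have := mul_le_mul_of_nonneg_left (by linarith : ‖x‖ ≤ rexp ‖x‖) K.2
    simp only [NNReal.val_eq_coe] at this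
    linarith
  have main : ∀ δ > 0, ∫ x, rexp (l * f x) ∂μ ≤
      rexp (l * ∫ x, f x ∂μ + l ^ 2 * K ^ 2 / 2 + 2 * l * K * δ) := by
    intro δ hδ
    obtain ⟨g, hgC, hgL, hgf⟩ := exists_smooth hL hδ
    calc ∫ x, rexp (l * f x) ∂μ ≤ ∫ x, rexp (l * K * δ) * rexp (l * g x) ∂μ := by
          refine integral_mono (hint hL) ((hint hgL).const_mul _) fun x => ?_
          simp only
          rw [← exp_add]
          apply exp_le_exp.2
          have := (abs_le.1 (hgf x)).1
          have := mul_le_mul_of_nonneg_left (by linarith : f x ≤ K * δ + g x) hl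
          linarith
      _ = rexp (l * K * δ) * ∫ x, rexp (l * g x) ∂μ := integral_const_mul _ _
      _ ≤ rexp (l * K * δ) * rexp (l * ∫ x, g x ∂μ + l ^ 2 * K ^ 2 / 2) := by
          gcongr
          exact mgf_smooth hgC hgL hl
      _ ≤ _ := by
          rw [← exp_add]
          apply exp_le_exp.2
          have h1 : ∫ x, g x ∂μ ≤ ∫ x, (f x + K * δ) ∂μ :=
            integral_mono (hint1 hgL) ((hint1 hL).add (integrable_const _)) fun x => by
              have := (abs_le.1 (hgf x)).2
              simp only; linarith
          rw [integral_add (hint1 hL) (integrable_const _)] at h1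
          simp at h1
          have := mul_le_mul_of_nonneg_left h1 hl
          linarith
  have hc : Filter.Tendsto (fun δ : ℝ =>
      rexp (l * ∫ x, f x ∂μ + l ^ 2 * K ^ 2 / 2 + 2 * l * K * δ)) (nhdsWithin 0 (Set.Ioi 0))
      (nhds (rexp (l * ∫ x, f x ∂μ + l ^ 2 * K ^ 2 / 2 + 2 * l * K * 0))) :=
    ((by fun_prop : Continuous fun δ : ℝ =>
      rexp (l * ∫ x, f x ∂μ + l ^ 2 * K ^ 2 / 2 + 2 * l * K * δ)).tendsto 0).mono_left
      nhdsWithin_le_nhds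
  have := ge_of_tendsto hc (Filter.eventually_of_mem self_mem_nhdsWithin fun δ hδ => main δ hδ)
  simpa using this

/-- Gaussian concentration for Lipschitz functions, sharp constant. -/
lemma concentration {f : E → ℝ} {K : ℝ≥0} (hK : 0 < K) (hL : LipschitzWith K f) {s : ℝ}
    (hs : 0 ≤ s) :
    (stdGaussian E).real {x | ∫ y, f y ∂(stdGaussian E) + s ≤ f x} ≤
      rexp (-(s ^ 2 / (2 * K ^ 2))) := by
  have hfc := hL.continuous
  have hK' : (0:ℝ) < K := hK
  have hl : 0 ≤ s / K ^ 2 := by positivity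
  have hint : Integrable (fun x => rexp (s / K ^ 2 * f x)) (stdGaussian E) :=
    integrable_of_growth (by fun_prop)
        (fun x => by rw [abs_of_pos (exp_pos _)]; exact lip_growth hL hl x)
  refine (measure_ge_le_exp_mul_mgf _ hl hint).trans ?_
  have := mgf_lip hL hl
  calc _ ≤ rexp (-(s / K ^ 2) * (∫ y, f y ∂(stdGaussian E) + s)) *
      rexp (s / K ^ 2 * ∫ x, f x ∂(stdGaussian E) + (s / K ^ 2) ^ 2 * K ^ 2 / 2) := by
        gcongr
        exact this
    _ = _ := by
      rw [← exp_add]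
      congr 1
      field_simp
      ring

end conc


section app

lemma sqNorm_eq {n : ℕ} (v : Fin n → ℝ) : sqNorm v = ‖WithLp.toLp 2 v‖ ^ 2 := by
  rw [EuclideanSpace.norm_sq_eq]; simp [sqNorm]

lemma l2norm_eq {n : ℕ} (v : Fin n → ℝ) : l2norm v = ‖WithLp.toLp 2 v‖ := by
  rw [l2norm, sqNorm_eq, Real.sqrt_sq (norm_nonneg _)]

lemma abs_dot_le {n : ℕ} (v w : Fin n → ℝ) : |v ⬝ᵥ w| ≤ ‖WithLp.toLp 2 v‖ * l2norm w := by
  rw [l2norm_eq]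
  have := abs_real_inner_le_norm (WithLp.toLp 2 v) (WithLp.toLp 2 w)
  rw [EuclideanSpace.inner_eq_star_dotProduct] at this
  simpa [dotProduct_comm] using this

lemma sup_le_abs {n : ℕ} {S : Set (Fin n → ℝ)} {ε : ℝ} (hS : ∀ θ ∈ S, l2norm θ ≤ ε)
    (x θ : Fin n → ℝ) (hθ : θ ∈ S) :
    |x ⬝ᵥ θ| ≤ sSup ((fun θ => |x ⬝ᵥ θ|) '' S) := by
  refine le_csSup ⟨‖WithLp.toLp 2 x‖ * ε, ?_⟩ ⟨θ, hθ, rfl⟩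
  rintro _ ⟨η, hη, rfl⟩
  exact (abs_dot_le x η).trans (mul_le_mul_of_nonneg_left (hS η hη) (norm_nonneg _))

lemma sup_lip {n : ℕ} {S : Set (Fin n → ℝ)} {ε : ℝ≥0} (hne : S.Nonempty)
    (hS : ∀ θ ∈ S, l2norm θ ≤ ε) :
    LipschitzWith ε (fun x : EuclideanSpace ℝ (Fin n) =>
      sSup ((fun θ => |x.ofLp ⬝ᵥ θ|) '' S)) := by
  refine LipschitzWith.of_le_add_mul ε fun x y => ?_
  refine csSup_le (hne.image _) ?_
  rintro _ ⟨θ, hθ, rfl⟩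
  have h1 := sup_le_abs hS y.ofLp θ hθ
  have h2 : |(x.ofLp - y.ofLp) ⬝ᵥ θ| ≤ dist x y * ε := by
    refine (abs_dot_le _ _).trans ?_
    rw [dist_eq_norm]
    exact mul_le_mul_of_nonneg_left (hS θ hθ) (norm_nonneg _)
  have h3 : x.ofLp ⬝ᵥ θ = y.ofLp ⬝ᵥ θ + (x.ofLp - y.ofLp) ⬝ᵥ θ := by
    rw [sub_dotProduct]; ring
  simp only
  rw [h3]
  have := abs_add_le (y.ofLp ⬝ᵥ θ) ((x.ofLp - y.ofLp) ⬝ᵥ θ)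
  linarith

lemma stdGaussPi_map (n : ℕ) :
    (stdGaussPi n).map (WithLp.toLp 2) = stdGaussian (EuclideanSpace ℝ (Fin n)) :=
  map_pi_eq_stdGaussian

lemma gaussPi_eq (n : ℕ) (σ : ℝ) :
    gaussPi n σ = (stdGaussPi n).map (fun w => fun i => σ * w i) := by
  unfold gaussPi stdGaussPi
  have h0 : (gaussianReal 0 1).map (fun x : ℝ => σ * x) = gaussianReal 0 (σ ^ 2).toNNReal := by
    rw [gaussianReal_map_const_mul]
    congr 1
    · simp
    · rw [mul_one]; ext; simp [sq_nonneg]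
  have h1 : ∀ _ : Fin n, SigmaFinite ((gaussianReal 0 1).map (fun x : ℝ => σ * x)) := by
    intro _
    rw [h0]; infer_instance
  rw [Measure.pi_map_pi (μ := fun _ : Fin n => gaussianReal 0 1)
    (f := fun _ : Fin n => fun x : ℝ => σ * x) (hμ := h1) (fun _ => by fun_prop)]
  simp only [h0]

end app
end CLS

/-- high-probability tail bound for the error of constrained least
squares (eq. (40)). -/
theorem constrained_ls_tail_bound
    {n d : ℕ} (hn : 0 < n)
    (C : Set (Fin d → ℝ)) (xstar : Fin d → ℝ) (hx : xstar ∈ C)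
    (A : Matrix (Fin n) (Fin d) ℝ) (σ : ℝ) (hσ : 0 < σ)
    (ε : ℝ) (hε : 0 < ε)
    (hcrit : σ * gaussWidth ε (Kstar A C xstar) ≤ ε ^ 2 * Real.sqrt n)
    (xLS : (Fin n → ℝ) → (Fin d → ℝ)) (hmeas : Measurable xLS)
    (hmin : ∀ w : Fin n → ℝ, xLS w ∈ C ∧ ∀ x ∈ C,
      sqNorm ((A.mulVec xstar + w) - A.mulVec (xLS w))
        ≤ sqNorm ((A.mulVec xstar + w) - A.mulVec x)) :
    ∀ t : ℝ, ε ≤ t →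
      gaussPi n σ {w | 16 * t * ε ≤ (1 / (n : ℝ)) * sqNorm (A.mulVec (xLS w - xstar))}
        ≤ ENNReal.ofReal (Real.exp (-((n : ℝ) * t * ε) / (2 * σ ^ 2))) := by
  intro t ht
  have htpos : 0 < t := hε.trans_le ht
  have hn' : (0:ℝ) < n := by exact_mod_cast hn
  set r := Real.sqrt n with hr
  have hrpos : 0 < r := Real.sqrt_pos.2 hn'
  have hr2 : r ^ 2 = n := Real.sq_sqrt hn'.le
  set u := Real.sqrt (t * ε) with hu
  have hu2 : u ^ 2 = t * ε := Real.sq_sqrt (by positivity)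
  have hupos : 0 < u := Real.sqrt_pos.2 (by positivity)
  have huε : ε ≤ u := by
    apply Real.le_sqrt_of_sq_le
    nlinarith
  set S := {θ ∈ Kstar A C xstar | l2norm θ ≤ ε} with hSdef
  obtain ⟨K, hK⟩ : ∃ K : NNReal, (K : ℝ) = ε := ⟨ε.toNNReal, Real.coe_toNNReal _ hε.le⟩
  have hS : ∀ θ ∈ S, l2norm θ ≤ (K : ℝ) := fun θ hθ => hθ.2.trans hK.ge
  have hne : S.Nonempty := by
    refine ⟨0, ⟨0, ⟨le_rfl, zero_le_one⟩, xstar, hx, by simp⟩, ?_⟩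
    simp [l2norm, sqNorm, hε.le]
  have hlip := CLS.sup_lip hne hS
  set Z : EuclideanSpace ℝ (Fin n) → ℝ := fun x => sSup ((fun θ => |x.ofLp ⬝ᵥ θ|) '' S) with hZ
  have hZc : Continuous Z := hlip.continuous
  have hW : gaussWidth ε (Kstar A C xstar) =
      ∫ x, Z x ∂(ProbabilityTheory.stdGaussian (EuclideanSpace ℝ (Fin n))) := by
    rw [← CLS.stdGaussPi_map, integral_map (by fun_prop) hZc.aestronglyMeasurable]
    rfl
  rw [hW] at hcrit
  set m := ∫ x, Z x ∂(ProbabilityTheory.stdGaussian (EuclideanSpace ℝ (Fin n))) with hm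
  set s := ε * u * r / σ with hs
  have hspos : 0 < s := by positivity
  have hms : m ≤ s := by
    rw [hs, le_div_iff₀ hσ]
    calc m * σ ≤ ε ^ 2 * r := by linarith
      _ = ε * ε * r := by ring
      _ ≤ _ := by gcongr
  have hconc := CLS.concentration (K := K) (by rw [← NNReal.coe_pos, hK]; exact hε) hlip hspos.le
  have hexp : -(s ^ 2 / (2 * (K : ℝ) ^ 2)) = -((n : ℝ) * t * ε) / (2 * σ ^ 2) := by
    rw [hK, hs, div_pow, mul_pow, mul_pow, hu2, hr2]
    field_simp
  rw [hexp] at hconc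
  have hsub : {w | 16 * t * ε ≤ (1 / (n : ℝ)) * sqNorm (A.mulVec (xLS w - xstar))} ⊆
      {w | m + s ≤ Z (WithLp.toLp 2 (fun i => σ⁻¹ * w i))} := by
    intro w hw
    simp only [Set.mem_ofPred_eq] at hw ⊢
    obtain ⟨hC, hopt⟩ := hmin w
    set Δ := A.mulVec (xLS w - xstar) with hΔ
    -- basic inequality
    have hbasic : sqNorm Δ ≤ 2 * (w ⬝ᵥ Δ) := by
      have h1 := hopt xstar hx
      have e1 : (A.mulVec xstar + w) - A.mulVec (xLS w) = w - Δ := by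
        rw [hΔ, Matrix.mulVec_sub]; abel
      have e2 : (A.mulVec xstar + w) - A.mulVec xstar = w := by abel
      rw [e1, e2] at h1
      have e3 : sqNorm (w - Δ) = sqNorm w - 2 * (w ⬝ᵥ Δ) + sqNorm Δ := by
        simp only [sqNorm, dotProduct, Pi.sub_apply, Finset.mul_sum]
        rw [← Finset.sum_sub_distrib, ← Finset.sum_add_distrib]
        exact Finset.sum_congr rfl fun i _ => by ring
      linarith
    set N := l2norm Δ with hN
    have hN0 : 0 ≤ N := Real.sqrt_nonneg _
    have hN2 : N ^ 2 = sqNorm Δ := Real.sq_sqrt (Finset.sum_nonneg fun i _ => sq_nonneg _)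
    have hNbig : 4 * u * r ≤ N := by
      refine (sq_le_sq₀ (by positivity) hN0).1 ?_
      rw [hN2, mul_pow, mul_pow, hu2, hr2]
      rw [one_div, le_inv_mul_iff₀ hn'] at hw
      linarith
    have hNpos : 0 < N := lt_of_lt_of_le (by positivity) hNbig
    -- rescaled vector
    set τ := ε * r / N with hτ
    have hτ1 : τ ≤ 1 := by
      rw [hτ, div_le_one hNpos]
      have : ε * r ≤ u * r := by gcongr
      have : 0 < u * r := by positivity
      linarith
    have hτ0 : 0 < τ := by positivity
    have hθS : (τ / r) • Δ ∈ S := by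
      refine ⟨⟨τ, ⟨hτ0.le, hτ1⟩, xLS w, hC, rfl⟩, ?_⟩
      rw [CLS.l2norm_eq, WithLp.toLp_smul, norm_smul, ← CLS.l2norm_eq, ← hN,
        Real.norm_of_nonneg (by positivity), hτ]
      apply le_of_eq
      field_simp
    have hsup := CLS.sup_le_abs hS (fun i => σ⁻¹ * w i) _ hθS
    have hdot : (fun i => σ⁻¹ * w i) ⬝ᵥ ((τ / r) • Δ) = σ⁻¹ * (τ / r) * (w ⬝ᵥ Δ) := by
      have : (fun i => σ⁻¹ * w i) = σ⁻¹ • w := rfl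
      rw [this, smul_dotProduct, dotProduct_smul, smul_eq_mul, smul_eq_mul]; ring
    rw [hdot] at hsup
    refine le_trans ?_ hsup
    refine le_trans ?_ (le_abs_self _)
    have h5 : N ^ 2 / 2 ≤ w ⬝ᵥ Δ := by rw [hN2]; linarith
    calc m + s ≤ 2 * s := by linarith
      _ = σ⁻¹ * ε * (4 * u * r) / 2 := by rw [hs]; field_simp; ring
      _ ≤ σ⁻¹ * ε * N / 2 := by gcongr
      _ = σ⁻¹ * (τ / r) * (N ^ 2 / 2) := by rw [hτ]; field_simp
      _ ≤ _ := by gcongr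
  refine (measure_mono hsub).trans ?_
  have hZm : Measurable fun w : Fin n → ℝ => Z (WithLp.toLp 2 (fun i => σ⁻¹ * w i)) :=
    hZc.measurable.comp (by fun_prop)
  have hms1 : MeasurableSet {w : Fin n → ℝ | m + s ≤ Z (WithLp.toLp 2 (fun i => σ⁻¹ * w i))} :=
    measurableSet_le measurable_const hZm
  rw [CLS.gaussPi_eq, Measure.map_apply (by fun_prop) hms1]
  have hset : (fun w : Fin n → ℝ => fun i => σ * w i) ⁻¹'
      {w | m + s ≤ Z (WithLp.toLp 2 (fun i => σ⁻¹ * w i))} =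
      (WithLp.toLp 2) ⁻¹' {x | m + s ≤ Z x} := by
    ext w
    simp only [Set.mem_preimage, Set.mem_ofPred_eq]
    have : (fun i => σ⁻¹ * (σ * w i)) = w := by
      ext i; field_simp
    rw [this]
  rw [hset, ← Measure.map_apply (by fun_prop)
    (measurableSet_le measurable_const hZc.measurable), CLS.stdGaussPi_map,
    ← ofReal_measureReal]
  exact ENNReal.ofReal_le_ofReal hconc
end

section
/- Let C ⊆ ℝ^d contain x*, let A ∈ ℝ^{n×d}, σ > 0, and let K* = {(t/√n)·A(x − x*) : t ∈ [0,1], x ∈ C}. If u > 0 satisfies (σ/√n)·W_u(K*) ≤ u², then for g ∈ ℝⁿ with i.i.d. standard normal coordinates, the probability of the event { there exists x ∈ C with (1/√n)‖A(x − x*)‖₂ ≥ u and |(σ/n)·⟨g, A(x − x*)⟩| ≥ 2u·(1/√n)‖A(x − x*)‖₂ } is at most exp(−n·u²/(2σ²)). -/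
open MeasureTheory Matrix

open ProbabilityTheory

/-- The `ℓ₁` norm, used as a convenient dominating function. -/
noncomputable def l1n {n : ℕ} (g : Fin n → ℝ) : ℝ := ∑ i, |g i|

lemma l1n_nonneg {n : ℕ} (g : Fin n → ℝ) : 0 ≤ l1n g :=
  Finset.sum_nonneg fun _ _ => abs_nonneg _

lemma l1n_continuous {n : ℕ} : Continuous (l1n : (Fin n → ℝ) → ℝ) := by
  unfold l1n; fun_prop

lemma l1n_smul {n : ℕ} (a : ℝ) (g : Fin n → ℝ) : l1n (a • g) = |a| * l1n g := by
  simp [l1n, abs_mul, Finset.mul_sum]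

lemma abs_dot_le {n : ℕ} {L : ℝ} (hL : 0 ≤ L) (v h : Fin n → ℝ) (hv : ∑ i, (v i) ^ 2 ≤ L ^ 2) :
    |v ⬝ᵥ h| ≤ L * l1n h := by
  have hi : ∀ i, |v i| ≤ L := fun i => by
    refine abs_le_of_sq_le_sq ?_ hL
    exact (Finset.single_le_sum (f := fun i => (v i) ^ 2) (fun _ _ => sq_nonneg _)
      (Finset.mem_univ i)).trans hv
  unfold dotProduct l1n
  rw [Finset.mul_sum]
  refine (Finset.abs_sum_le_sum_abs _ _).trans (Finset.sum_le_sum fun i _ => ?_)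
  rw [abs_mul]
  exact mul_le_mul_of_nonneg_right (hi i) (abs_nonneg _)

instance stdGaussPi_prob (n : ℕ) : IsProbabilityMeasure (stdGaussPi n) := by
  unfold stdGaussPi; infer_instance

lemma integrable_exp_l1n {n : ℕ} (c : ℝ) :
    Integrable (fun g => Real.exp (c * l1n g)) (stdGaussPi n) := by
  have h1 : Integrable (fun x : ℝ => Real.exp (c * |x|)) (gaussianReal 0 1) := by
    exact integrable_exp_mul_abs (integrable_exp_mul_gaussianReal c)
      (integrable_exp_mul_gaussianReal (-c))
  have := Integrable.fintype_prod (ι := Fin n) (f := fun _ (x : ℝ) => Real.exp (c * |x|))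
    (μ := fun _ => gaussianReal 0 1) (fun _ => h1)
  unfold stdGaussPi
  convert this using 2 with g
  rw [l1n, Finset.mul_sum, Real.exp_sum]

lemma integrable_pow_exp_l1n {n : ℕ} (k : ℕ) (c : ℝ) :
    Integrable (fun g => l1n g ^ k * Real.exp (c * l1n g)) (stdGaussPi n) := by
  refine ((integrable_exp_l1n (n := n) (c + 1)).const_mul (k.factorial : ℝ)).mono'
    (((l1n_continuous.pow k).mul (Real.continuous_exp.comp
      (continuous_const.mul l1n_continuous))).aestronglyMeasurable) (ae_of_all _ fun g => ?_)
  have h0 := l1n_nonneg g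
  rw [Real.norm_of_nonneg (by positivity)]
  have := Real.pow_div_factorial_le_exp _ h0 k
  rw [div_le_iff₀ (by positivity)] at this
  rw [add_mul, Real.exp_add, one_mul]
  nlinarith [Real.exp_pos (c * l1n g)]

lemma integrable_pow_l1n {n : ℕ} (k : ℕ) :
    Integrable (fun g => l1n g ^ k) (stdGaussPi n) := by
  simpa using integrable_pow_exp_l1n (n := n) k 0

lemma integrable_l1n {n : ℕ} : Integrable (fun g => l1n g) (stdGaussPi n) := by
  simpa using integrable_pow_l1n (n := n) 1

lemma mp_add {n : ℕ} : MeasurePreserving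
    (fun p : (Fin n → ℝ) × (Fin n → ℝ) => (Real.sqrt 2)⁻¹ • (p.1 + p.2))
    ((stdGaussPi n).prod (stdGaussPi n)) (stdGaussPi n) := by
  have h1 : MeasurePreserving (fun p : ℝ × ℝ => (Real.sqrt 2)⁻¹ * (p.1 + p.2))
      ((gaussianReal 0 1).prod (gaussianReal 0 1)) (gaussianReal 0 1) := by
    refine ⟨by fun_prop, ?_⟩
    have h2 := gaussianReal_conv_gaussianReal (m₁ := 0) (m₂ := 0) (v₁ := 1) (v₂ := 1)
    have h3 := gaussianReal_map_const_mul (μ := 0 + 0) (v := 1 + 1) ((Real.sqrt 2)⁻¹)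
    rw [← h2, Measure.conv, Measure.map_map (by fun_prop) (by fun_prop)] at h3
    refine h3.trans ?_
    congr 1
    · simp
    · ext; push_cast; rw [inv_pow, Real.sq_sqrt (by norm_num)]; norm_num
  have h2 := measurePreserving_pi (ι := Fin n) (fun _ => (gaussianReal 0 1).prod (gaussianReal 0 1))
    (fun _ => gaussianReal 0 1) (fun _ => h1)
  have h3 := (measurePreserving_arrowProdEquivProdArrow ℝ ℝ (Fin n)
    (fun _ => gaussianReal 0 1) (fun _ => gaussianReal 0 1)).symm
  exact h2.comp h3

lemma memLp_mul {n : ℕ} (v : Fin n → ℝ) (i : Fin n) :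
    MemLp (fun x : ℝ => v i * x) 2 (gaussianReal 0 1) :=
  (memLp_id_gaussianReal' 2 (by norm_num)).const_mul (v i)

lemma integral_dot {n : ℕ} (v : Fin n → ℝ) : ∫ g, (v ⬝ᵥ g) ∂stdGaussPi n = 0 := by
  unfold dotProduct stdGaussPi
  rw [integral_finsetSum]
  · refine Finset.sum_eq_zero fun i _ => ?_
    rw [integral_const_mul]
    have := integral_comp_eval (μ := fun _ : Fin n => gaussianReal 0 1) (i := i)
      (f := fun x : ℝ => x) (by fun_prop)
    rw [this]
    simp
  · intro i _
    exact integrable_comp_eval (μ := fun _ : Fin n => gaussianReal 0 1) (i := i)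
      (f := fun x : ℝ => v i * x) ((memLp_mul v i).integrable (by norm_num))

lemma integral_dot_sq {n : ℕ} (v : Fin n → ℝ) :
    ∫ g, (v ⬝ᵥ g) ^ 2 ∂stdGaussPi n = ∑ i, (v i) ^ 2 := by
  have hm : ∀ i, MemLp (fun x : ℝ => v i * x) 2 (gaussianReal 0 1) := fun i =>
    (memLp_id_gaussianReal' 2 (by norm_num)).const_mul (v i)
  have h := variance_sum_pi (μ := fun _ : Fin n => gaussianReal 0 1) (X := fun i x => v i * x) hm
  have hmean := integral_dot v
  have h4 : Var[fun g => v ⬝ᵥ g; stdGaussPi n] = ∑ i, (v i) ^ 2 := by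
    have e : (fun g => v ⬝ᵥ g) = (∑ i, fun g : Fin n → ℝ => v i * g i) := by
      ext g; simp [dotProduct]
    rw [e]; unfold stdGaussPi; rw [h]
    refine Finset.sum_congr rfl fun i _ => ?_
    rw [variance_const_mul]
    have := variance_id_gaussianReal (μ := 0) (v := 1)
    change _ * Var[id; _] = _
    rw [this]; simp
  rw [← h4, variance_of_integral_eq_zero _ hmean]
  exact (show Continuous fun g : Fin n → ℝ => ∑ i, v i * g i by fun_prop).aemeasurable

/-- Smooth Lipschitz functions with an explicit (measurable) gradient. -/
structure SmCls {n : ℕ} (L M : ℝ) (F : (Fin n → ℝ) → ℝ) (v : (Fin n → ℝ) → (Fin n → ℝ)) : Prop where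
  meas : Measurable v
  vb : ∀ x, ∑ i, (v x i) ^ 2 ≤ L ^ 2
  tay : ∀ x h, |F (x + h) - F x - v x ⬝ᵥ h| ≤ M * l1n h ^ 2
  lip : ∀ x h, |F (x + h) - F x| ≤ L * l1n h

lemma cont_of_lip {n : ℕ} {L : ℝ} {F : (Fin n → ℝ) → ℝ}
    (h : ∀ x h, |F (x + h) - F x| ≤ L * l1n h) : Continuous F := by
  rw [continuous_iff_continuousAt]
  intro x
  rw [ContinuousAt, tendsto_iff_dist_tendsto_zero]
  have h1 : Filter.Tendsto (fun y => L * l1n (y - x)) (nhds x) (nhds 0) := by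
    have : Continuous fun y => L * l1n (y - x) :=
      continuous_const.mul (l1n_continuous.comp (continuous_id.sub continuous_const))
    have := this.tendsto x
    simpa [l1n] using this
  refine squeeze_zero (fun _ => dist_nonneg) (fun y => ?_) h1
  have := h x (y - x)
  rw [add_sub_cancel] at this
  exact this

lemma lip_integrable {n : ℕ} {L : ℝ} {F : (Fin n → ℝ) → ℝ}
    (h : ∀ x h, |F (x + h) - F x| ≤ L * l1n h) (x : Fin n → ℝ) (a : ℝ) :
    Integrable (fun g => F (x + a • g)) (stdGaussPi n) := by
  have hc := cont_of_lip h
  refine ((integrable_const |F x|).add ((integrable_l1n (n := n)).const_mul (L * |a|))).mono'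
    (by fun_prop) (ae_of_all _ fun g => ?_)
  have := h x (a • g)
  rw [l1n_smul, ← mul_assoc] at this
  have h2 := abs_add_le (F x) (F (x + a • g) - F x)
  rw [add_sub_cancel] at h2
  simp only [Real.norm_eq_abs, Pi.add_apply]
  linarith

lemma lip_integrable_exp {n : ℕ} {L : ℝ} {F : (Fin n → ℝ) → ℝ}
    (h : ∀ x h, |F (x + h) - F x| ≤ L * l1n h) (x : Fin n → ℝ) (a : ℝ) :
    Integrable (fun g => Real.exp (F (x + a • g))) (stdGaussPi n) := by
  have hc := cont_of_lip h
  refine ((integrable_exp_l1n (n := n) (L * |a|)).const_mul (Real.exp (F x))).mono'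
    (Continuous.aestronglyMeasurable (by fun_prop)) (ae_of_all _ fun g => ?_)
  have := h x (a • g)
  rw [l1n_smul, ← mul_assoc] at this
  rw [Real.norm_of_nonneg (Real.exp_pos _).le, ← Real.exp_add, Real.exp_le_exp]
  linarith [le_abs_self (F (x + a • g) - F x)]

lemma exp_taylor (x : ℝ) : Real.exp x ≤ 1 + x + x ^ 2 / 2 + |x| ^ 3 * Real.exp |x| := by
  have h := Complex.norm_exp_sub_sum_le_norm_mul_exp (x : ℂ) 3
  have e : Complex.exp (x : ℂ) - ∑ m ∈ Finset.range 3, (x : ℂ) ^ m / m.factorial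
      = ((Real.exp x - (1 + x + x ^ 2 / 2) : ℝ) : ℂ) := by
    simp [Finset.sum_range_succ]
  rw [e, Complex.norm_real, Complex.norm_real, Real.norm_eq_abs, Real.norm_eq_abs] at h
  linarith [le_abs_self (Real.exp x - (1 + x + x ^ 2 / 2))]

/-- The dominating error term. -/
noncomputable def Herr (L M m q t : ℝ) : ℝ :=
  L * M * t * (t ^ 2 + q) + M ^ 2 * (t ^ 2 + q) ^ 2 + L ^ 3 * (t + m) ^ 3 * Real.exp (L * (t + m))

lemma exp_pointwise {L M m q t a w D : ℝ} (hL : 0 ≤ L) (hm : 0 ≤ m) (hq : 0 ≤ q)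
    (ht : 0 ≤ t) (ha : 0 ≤ a) (ha1 : a ≤ 1) (hw : |w| ≤ L * t)
    (hR : |D - a * w| ≤ M * a ^ 2 * (t ^ 2 + q)) (hD : |D| ≤ a * (L * (t + m))) :
    Real.exp D ≤ 1 + D + a ^ 2 * w ^ 2 / 2 + a ^ 3 * Herr L M m q t := by
  have h1 := exp_taylor D
  have h2 : |D| ^ 3 * Real.exp |D| ≤ (a * (L * (t + m))) ^ 3 * Real.exp (L * (t + m)) := by
    have : |D| ≤ L * (t + m) := hD.trans (mul_le_of_le_one_left (by positivity) ha1)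
    gcongr
  set Q := t ^ 2 + q with hQ
  have hQ0 : 0 ≤ Q := by positivity
  have h3 : D ^ 2 / 2 ≤ a ^ 2 * w ^ 2 / 2 + a ^ 3 * (L * M * t * Q + M ^ 2 * Q ^ 2) := by
    have e : D ^ 2 = a ^ 2 * w ^ 2 + 2 * (a * w * (D - a * w)) + (D - a * w) ^ 2 := by ring
    have e1 : a * w * (D - a * w) ≤ a * (L * t) * (M * a ^ 2 * Q) := by
      refine (le_abs_self _).trans ?_
      rw [abs_mul, abs_mul, abs_of_nonneg ha]
      gcongr
    have e2 : (D - a * w) ^ 2 ≤ (M * a ^ 2 * Q) ^ 2 := sq_le_sq' (by linarith [neg_abs_le (D - a * w)])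
      ((le_abs_self _).trans hR)
    have e3 : (M * a ^ 2 * Q) ^ 2 ≤ a ^ 3 * (M ^ 2 * Q ^ 2) := by
      have : a ^ 4 ≤ a ^ 3 := pow_le_pow_of_le_one ha ha1 (by norm_num)
      have h0 : 0 ≤ M ^ 2 * Q ^ 2 := by positivity
      nlinarith
    have e4 : 0 ≤ a ^ 3 * (M ^ 2 * Q ^ 2) := by positivity
    nlinarith
  unfold Herr
  rw [← hQ]
  nlinarith

lemma integrable_Herr {n : ℕ} (L M m q : ℝ) :
    Integrable (fun g => Herr L M m q (l1n g)) (stdGaussPi n) := by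
  have hp := fun k => integrable_pow_l1n (n := n) k
  have he := fun k => integrable_pow_exp_l1n (n := n) k L
  have e : (fun g : Fin n → ℝ => Herr L M m q (l1n g)) = fun g =>
      (((L * M) * l1n g ^ 3 + (L * M * q) * l1n g ^ 1) +
      (M ^ 2 * l1n g ^ 4 + (2 * M ^ 2 * q) * l1n g ^ 2 + (M ^ 2 * q ^ 2) * l1n g ^ 0)) +
      (L ^ 3 * Real.exp (L * m)) * (l1n g ^ 3 * Real.exp (L * l1n g)
        + (3 * m) * (l1n g ^ 2 * Real.exp (L * l1n g))
        + (3 * m ^ 2) * (l1n g ^ 1 * Real.exp (L * l1n g))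
        + (m ^ 3) * (l1n g ^ 0 * Real.exp (L * l1n g))) := by
    ext g
    unfold Herr
    rw [mul_add L, Real.exp_add]
    ring
  rw [e]
  exact ((((hp 3).const_mul _).add ((hp 1).const_mul _)).add
    ((((hp 4).const_mul _).add ((hp 2).const_mul _)).add ((hp 0).const_mul _))).add
    (((((he 3).add ((he 2).const_mul _)).add ((he 1).const_mul _)).add
      ((he 0).const_mul _)).const_mul _)

lemma onestep {n : ℕ} {L M : ℝ} (hL : 0 ≤ L) (hM : 0 ≤ M) :
    ∃ K : ℝ, ∀ (F : (Fin n → ℝ) → ℝ) (v : (Fin n → ℝ) → (Fin n → ℝ)), SmCls L M F v →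
      ∀ a : ℝ, 0 ≤ a → a ≤ 1 → ∀ x, ∫ g, Real.exp (F (x + a • g)) ∂stdGaussPi n ≤
        Real.exp (∫ g, F (x + a • g) ∂stdGaussPi n + (a ^ 2 * L ^ 2 / 2 + a ^ 3 * K)) := by
  set m := ∫ g, l1n g ∂stdGaussPi n with hm
  set q := ∫ g, l1n g ^ 2 ∂stdGaussPi n with hq
  have hm0 : 0 ≤ m := integral_nonneg fun g => l1n_nonneg g
  have hq0 : 0 ≤ q := integral_nonneg fun g => sq_nonneg _
  refine ⟨∫ g, Herr L M m q (l1n g) ∂stdGaussPi n, fun F v hF a ha ha1 x => ?_⟩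
  set μ := ∫ g, F (x + a • g) ∂stdGaussPi n with hμ
  have hFi := lip_integrable hF.lip x a
  have hdc : Continuous fun g : Fin n → ℝ => v x ⬝ᵥ g := by unfold dotProduct; fun_prop
  have hdi : Integrable (fun g => v x ⬝ᵥ g) (stdGaussPi n) :=
    ((integrable_l1n (n := n)).const_mul L).mono' hdc.aestronglyMeasurable
      (ae_of_all _ fun g => abs_dot_le hL _ _ (hF.vb x))
  have hdi2 : Integrable (fun g => (v x ⬝ᵥ g) ^ 2) (stdGaussPi n) := by
    refine ((integrable_pow_l1n (n := n) 2).const_mul (L ^ 2)).mono'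
      (hdc.pow 2).aestronglyMeasurable (ae_of_all _ fun g => ?_)
    have := abs_dot_le hL _ g (hF.vb x)
    rw [Real.norm_of_nonneg (sq_nonneg _), ← mul_pow, ← sq_abs]
    gcongr
  have hal : ∀ g, l1n (a • g) = a * l1n g := fun g : Fin n → ℝ => by
    rw [l1n_smul, abs_of_nonneg ha]
  -- mean is close to `F x`
  have hmean1 : |F x - μ| ≤ M * a ^ 2 * q := by
    have e : F x - μ = ∫ g, -(F (x + a • g) - F x - a * (v x ⬝ᵥ g)) ∂stdGaussPi n := by
      have hFs : Integrable (fun g => F (x + a • g) - F x) (stdGaussPi n) :=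
        hFi.sub (integrable_const _)
      rw [integral_neg, integral_sub hFs (hdi.const_mul a),
        integral_sub hFi (integrable_const _), integral_const_mul, integral_dot]
      simp [← hμ]
    rw [e, hq, ← integral_const_mul]
    rw [← Real.norm_eq_abs]
    refine norm_integral_le_of_norm_le ((integrable_pow_l1n 2).const_mul _) (ae_of_all _ fun g => ?_)
    have := hF.tay x (a • g)
    rw [hal, dotProduct_smul, smul_eq_mul] at this
    rw [norm_neg, Real.norm_eq_abs]
    linarith
  have hmean2 : |F x - μ| ≤ a * (L * m) := by
    have e : F x - μ = ∫ g, -(F (x + a • g) - F x) ∂stdGaussPi n := by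
      rw [integral_neg, integral_sub hFi (integrable_const _)]
      simp [← hμ]
    rw [e, hm, ← integral_const_mul, ← integral_const_mul]
    rw [← Real.norm_eq_abs]
    refine norm_integral_le_of_norm_le ((integrable_l1n.const_mul _).const_mul _)
      (ae_of_all _ fun g => ?_)
    have := hF.lip x (a • g)
    rw [hal] at this
    rw [norm_neg, Real.norm_eq_abs]
    linarith
  have hpt : ∀ g, Real.exp (F (x + a • g) - μ) ≤ 1 + (F (x + a • g) - μ)
      + a ^ 2 / 2 * (v x ⬝ᵥ g) ^ 2 + a ^ 3 * Herr L M m q (l1n g) := by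
    intro g
    have ht := hF.tay x (a • g)
    have hl := hF.lip x (a • g)
    rw [hal] at ht hl
    rw [dotProduct_smul, smul_eq_mul] at ht
    have h1 := exp_pointwise (M := M) (D := F (x + a • g) - μ) (w := v x ⬝ᵥ g) hL hm0 hq0 (l1n_nonneg g)
      ha ha1 (abs_dot_le hL _ g (hF.vb x)) ?_ ?_
    · linarith
    · have := abs_add_le (F (x + a • g) - F x - a * (v x ⬝ᵥ g)) (F x - μ)
      rw [show F (x + a • g) - F x - a * (v x ⬝ᵥ g) + (F x - μ) =
        F (x + a • g) - μ - a * (v x ⬝ᵥ g) by ring] at this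
      linarith
    · have := abs_add_le (F (x + a • g) - F x) (F x - μ)
      rw [sub_add_sub_cancel] at this
      linarith
  have hHi := integrable_Herr (n := n) L M m q
  have hD : Integrable (fun g => 1 + (F (x + a • g) - μ)) (stdGaussPi n) :=
    (integrable_const _).add (hFi.sub (integrable_const _))
  have hint := integral_mono (μ := stdGaussPi n)
    (f := fun g => Real.exp (F (x + a • g) - μ))
    (by simpa [Real.exp_sub] using (lip_integrable_exp hF.lip x a).div_const _)
    ((hD.add (hdi2.const_mul (a ^ 2 / 2))).add (hHi.const_mul (a ^ 3))) hpt
  simp only [Pi.add_apply] at hint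
  have hD2 : Integrable (fun g => 1 + (F (x + a • g) - μ) + a ^ 2 / 2 * (v x ⬝ᵥ g) ^ 2)
    (stdGaussPi n) := hD.add (hdi2.const_mul (a ^ 2 / 2))
  rw [integral_add hD2 (hHi.const_mul (a ^ 3)),
    integral_add hD (hdi2.const_mul (a ^ 2 / 2)),
    integral_add (integrable_const _) (show Integrable (fun g => F (x + a • g) - μ) _ from hFi.sub (integrable_const _)),
    integral_sub hFi (integrable_const _), integral_const_mul, integral_const_mul,
    integral_dot_sq] at hint
  simp only [Real.exp_sub, integral_div, integral_const, probReal_univ, smul_eq_mul, one_mul,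
    ← hμ, sub_self, add_zero] at hint
  rw [div_le_iff₀ (Real.exp_pos _)] at hint
  refine hint.trans ?_
  rw [Real.exp_add, mul_comm]
  refine mul_le_mul_of_nonneg_left ?_ (Real.exp_pos _).le
  refine le_trans ?_ (Real.add_one_le_exp _)
  have := hF.vb x
  nlinarith [sq_nonneg a]

lemma SmCls.v_le {n : ℕ} {L M : ℝ} (hL : 0 ≤ L) {F : (Fin n → ℝ) → ℝ}
    {v : (Fin n → ℝ) → (Fin n → ℝ)} (h : SmCls L M F v) (x : Fin n → ℝ) (i : Fin n) :
    |v x i| ≤ L := by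
  refine abs_le_of_sq_le_sq ?_ hL
  exact (Finset.single_le_sum (f := fun i => (v x i) ^ 2) (fun _ _ => sq_nonneg _)
      (Finset.mem_univ i)).trans (h.vb x)

lemma SmCls.avg {n : ℕ} {L M : ℝ} (hL : 0 ≤ L) {F : (Fin n → ℝ) → ℝ}
    {v : (Fin n → ℝ) → (Fin n → ℝ)} (h : SmCls L M F v) (a : ℝ) :
    SmCls L M (fun x => ∫ g, F (x + a • g) ∂stdGaussPi n)
      (fun x i => ∫ g, v (x + a • g) i ∂stdGaussPi n) := by
  have hmeas : ∀ x i, Measurable fun g => v (x + a • g) i := fun x i =>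
    (measurable_pi_apply i).comp (h.meas.comp (by fun_prop))
  have hvi : ∀ x i, Integrable (fun g => v (x + a • g) i) (stdGaussPi n) := fun x i =>
    (integrable_const L).mono' (hmeas x i).aestronglyMeasurable
      (ae_of_all _ fun g => h.v_le hL _ i)
  have hvi2 : ∀ x i, Integrable (fun g => v (x + a • g) i ^ 2) (stdGaussPi n) := fun x i =>
    (integrable_const (L ^ 2)).mono' ((hmeas x i).pow_const 2).aestronglyMeasurable
      (ae_of_all _ fun g => by
        rw [Real.norm_of_nonneg (sq_nonneg _)]
        exact sq_le_sq' (by linarith [neg_abs_le (v (x + a • g) i), h.v_le hL (x + a • g) i])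
          ((le_abs_self _).trans (h.v_le hL _ i)))
  have hFi := fun x => lip_integrable h.lip x a
  refine ⟨?_, fun x => ?_, fun x k => ?_, fun x k => ?_⟩
  · refine measurable_pi_lambda _ fun i => ?_
    have : Measurable (fun p : (Fin n → ℝ) × (Fin n → ℝ) => v (p.1 + a • p.2) i) :=
      (measurable_pi_apply i).comp (h.meas.comp (by fun_prop))
    exact this.stronglyMeasurable.integral_prod_right'.measurable
  · have h1 : ∀ i, (∫ g, v (x + a • g) i ∂stdGaussPi n) ^ 2 ≤
        ∫ g, v (x + a • g) i ^ 2 ∂stdGaussPi n := fun i => by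
      set c := ∫ g, v (x + a • g) i ∂stdGaussPi n with hc
      have h0 : 0 ≤ ∫ g, (v (x + a • g) i ^ 2 - 2 * c * v (x + a • g) i + c ^ 2) ∂stdGaussPi n :=
        integral_nonneg fun g => by
          change 0 ≤ _
          nlinarith [sq_nonneg (v (x + a • g) i - c)]
      have hi : Integrable (fun g => v (x + a • g) i ^ 2 - 2 * c * v (x + a • g) i) (stdGaussPi n) :=
        (hvi2 x i).sub ((hvi x i).const_mul _)
      rw [integral_add hi (integrable_const _), integral_sub (hvi2 x i) ((hvi x i).const_mul _),
        integral_const_mul, ← hc] at h0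
      simp at h0
      nlinarith
    calc _ ≤ ∑ i, ∫ g, v (x + a • g) i ^ 2 ∂stdGaussPi n := Finset.sum_le_sum fun i _ => h1 i
      _ = ∫ g, ∑ i, v (x + a • g) i ^ 2 ∂stdGaussPi n :=
        (integral_finsetSum _ fun i _ => hvi2 x i).symm
      _ ≤ ∫ _, L ^ 2 ∂stdGaussPi n :=
        integral_mono (integrable_finsetSum _ fun i _ => hvi2 x i) (integrable_const _)
          fun g => h.vb _
      _ = L ^ 2 := by simp
  · have hdi : Integrable (fun g => v (x + a • g) ⬝ᵥ k) (stdGaussPi n) := by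
      unfold dotProduct
      exact integrable_finsetSum _ fun i _ => (hvi x i).mul_const _
    have hd : (fun i => ∫ g, v (x + a • g) i ∂stdGaussPi n) ⬝ᵥ k
        = ∫ g, v (x + a • g) ⬝ᵥ k ∂stdGaussPi n := by
      unfold dotProduct
      rw [integral_finsetSum _ fun i _ => (hvi x i).mul_const _]
      simp_rw [integral_mul_const]
    have hFs : Integrable (fun g => F (x + k + a • g) - F (x + a • g)) (stdGaussPi n) :=
      (hFi (x + k)).sub (hFi x)
    rw [hd, ← integral_sub (hFi _) (hFi _), ← integral_sub hFs hdi, ← Real.norm_eq_abs]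
    refine (norm_integral_le_of_norm_le_const (C := M * l1n k ^ 2) (ae_of_all _ fun g => ?_)).trans
      (by simp)
    have := h.tay (x + a • g) k
    rwa [add_right_comm] at this
  · rw [← integral_sub (hFi _) (hFi _), ← Real.norm_eq_abs]
    refine (norm_integral_le_of_norm_le_const (C := L * l1n k) (ae_of_all _ fun g => ?_)).trans
      (by simp)
    have := h.lip (x + a • g) k
    rwa [add_right_comm] at this

lemma integral_double {n : ℕ} {f : (Fin n → ℝ) → ℝ} (hf : Continuous f) (x : Fin n → ℝ) (a : ℝ)
    (hi : Integrable (fun g => f (x + (Real.sqrt 2 * a) • g)) (stdGaussPi n)) :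
    ∫ g, f (x + (Real.sqrt 2 * a) • g) ∂stdGaussPi n =
      ∫ y, ∫ z, f (x + a • y + a • z) ∂stdGaussPi n ∂stdGaussPi n ∧
    Integrable (fun y => ∫ z, f (x + a • y + a • z) ∂stdGaussPi n) (stdGaussPi n) := by
  have hmp := mp_add (n := n)
  have hs : Real.sqrt 2 ≠ 0 := by positivity
  have e : ∀ p : (Fin n → ℝ) × (Fin n → ℝ),
      f (x + (Real.sqrt 2 * a) • ((Real.sqrt 2)⁻¹ • (p.1 + p.2))) = f (x + a • p.1 + a • p.2) := by
    intro p
    rw [smul_smul, mul_right_comm, mul_inv_cancel₀ hs, one_mul, smul_add, add_assoc]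
  have hi2 : Integrable (fun p : (Fin n → ℝ) × (Fin n → ℝ) => f (x + a • p.1 + a • p.2))
      ((stdGaussPi n).prod (stdGaussPi n)) := by
    have := hmp.integrable_comp_of_integrable hi
    refine this.congr (ae_of_all _ fun p => ?_)
    exact e p
  constructor
  · have h := integral_map hmp.measurable.aemeasurable
      (f := fun g => f (x + (Real.sqrt 2 * a) • g))
      (μ := (stdGaussPi n).prod (stdGaussPi n)) (Continuous.aestronglyMeasurable (by fun_prop))
    rw [hmp.map_eq] at h
    rw [h, ← integral_prod _ hi2]
    exact integral_congr_ae (ae_of_all _ e)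
  · exact hi2.integral_prod_left

/-- the exponential moment bound at scale `a` with constant `c`. -/
def EM (n : ℕ) (L M a c : ℝ) : Prop :=
  ∀ (F : (Fin n → ℝ) → ℝ) (v : (Fin n → ℝ) → (Fin n → ℝ)), SmCls L M F v →
    ∀ x, ∫ g, Real.exp (F (x + a • g)) ∂stdGaussPi n ≤
      Real.exp (∫ g, F (x + a • g) ∂stdGaussPi n + c)

lemma EM.double {n : ℕ} {L M a c : ℝ} (hL : 0 ≤ L) (h : EM n L M a c) :
    EM n L M (Real.sqrt 2 * a) (2 * c) := by
  intro F v hF x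
  have hc := cont_of_lip hF.lip
  have h1 := integral_double (f := fun y => Real.exp (F y)) (by fun_prop) x a
    (lip_integrable_exp hF.lip x _)
  have h2 := integral_double hc x a (lip_integrable hF.lip x _)
  rw [h1.1, h2.1]
  have hav := hF.avg hL a
  have h3 := h _ _ hav x
  have h4 := lip_integrable_exp
    (F := fun x => ∫ g, F (x + a • g) ∂stdGaussPi n) hav.lip x a
  calc _ ≤ ∫ y, Real.exp (∫ z, F (x + a • y + a • z) ∂stdGaussPi n) * Real.exp c ∂stdGaussPi n := by
        refine integral_mono h1.2 (h4.mul_const _) fun y => ?_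
        change _ ≤ _ * _
        rw [← Real.exp_add]
        exact h F v hF _
    _ ≤ Real.exp (∫ y, ∫ z, F (x + a • y + a • z) ∂stdGaussPi n ∂stdGaussPi n + c) * Real.exp c := by
        rw [integral_mul_const]
        exact mul_le_mul_of_nonneg_right h3 (Real.exp_pos _).le
    _ = _ := by rw [← Real.exp_add]; ring_nf

lemma EM.iter {n : ℕ} {L M a c : ℝ} (hL : 0 ≤ L) (h : EM n L M a c) (k : ℕ) :
    EM n L M (Real.sqrt 2 ^ k * a) (2 ^ k * c) := by
  induction k with
  | zero => simpa using h
  | succ k ih =>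
    have := ih.double hL
    rwa [← mul_assoc, ← mul_assoc, ← pow_succ', ← pow_succ'] at this

lemma SmCls.exp_moment {n : ℕ} {L M : ℝ} (hL : 0 ≤ L) (hM : 0 ≤ M) {F : (Fin n → ℝ) → ℝ}
    {v : (Fin n → ℝ) → (Fin n → ℝ)} (hF : SmCls L M F v) :
    ∫ g, Real.exp (F g) ∂stdGaussPi n ≤ Real.exp (∫ g, F g ∂stdGaussPi n + L ^ 2 / 2) := by
  obtain ⟨K, hK⟩ := onestep (n := n) hL hM
  have hs : (0 : ℝ) < Real.sqrt 2 := by positivity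
  have hs1 : (1 : ℝ) < Real.sqrt 2 := by
    rw [Real.lt_sqrt (by norm_num)]; norm_num
  have key : ∀ k : ℕ, ∫ g, Real.exp (F g) ∂stdGaussPi n ≤
      Real.exp (∫ g, F g ∂stdGaussPi n + (L ^ 2 / 2 + (Real.sqrt 2)⁻¹ ^ k * K)) := by
    intro k
    set a := (Real.sqrt 2)⁻¹ ^ k with ha
    have ha0 : 0 ≤ a := by positivity
    have ha1 : a ≤ 1 := pow_le_one₀ (by positivity) (inv_le_one_of_one_le₀ hs1.le)
    have h1 : EM n L M a (a ^ 2 * L ^ 2 / 2 + a ^ 3 * K) := fun F v hF x => hK F v hF a ha0 ha1 x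
    have h2 := h1.iter hL k F v hF 0
    have e1 : Real.sqrt 2 ^ k * a = 1 := by
      rw [ha, ← mul_pow, mul_inv_cancel₀ hs.ne', one_pow]
    have e2 : (2 : ℝ) ^ k = (Real.sqrt 2 ^ k) ^ 2 := by
      rw [← pow_mul, mul_comm, pow_mul, Real.sq_sqrt (by norm_num)]
    have e3 : 2 ^ k * (a ^ 2 * L ^ 2 / 2 + a ^ 3 * K) = L ^ 2 / 2 + a * K := by
      rw [e2]
      linear_combination (Real.sqrt 2 ^ k * a + 1) * (L ^ 2 / 2 + a * K) * e1
    rw [e1, e3] at h2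
    simpa using h2
  have hlim : Filter.Tendsto (fun k : ℕ => Real.exp (∫ g, F g ∂stdGaussPi n
      + (L ^ 2 / 2 + (Real.sqrt 2)⁻¹ ^ k * K))) Filter.atTop
      (nhds (Real.exp (∫ g, F g ∂stdGaussPi n + (L ^ 2 / 2 + 0 * K)))) := by
    refine (Real.continuous_exp.tendsto _).comp (Filter.Tendsto.const_add _
      (Filter.Tendsto.const_add _ (Filter.Tendsto.mul_const _ ?_)))
    exact tendsto_pow_atTop_nhds_zero_of_lt_one (by positivity) (inv_lt_one_of_one_lt₀ hs1)
  have := ge_of_tendsto' hlim key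
  simpa using this

lemma softmax_bounds {ι : Type*} [Fintype ι] (w y : ι → ℝ) (b : ℝ)
    (hw : ∀ i, 0 ≤ w i) (hw1 : ∑ i, w i = 1) (hy : ∀ i, |y i| ≤ b) :
    |Real.log (∑ i, w i * Real.exp (y i))| ≤ b ∧
    |Real.log (∑ i, w i * Real.exp (y i)) - ∑ i, w i * y i| ≤ 2 * b ^ 2 := by
  have hJ : Real.exp (∑ i, w i * y i) ≤ ∑ i, w i * Real.exp (y i) := by
    simpa using convexOn_exp.map_sum_le (t := Finset.univ) (w := w) (p := y)
      (fun i _ => hw i) hw1 (fun i _ => Set.mem_univ _)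
  have hpos : 0 < ∑ i, w i * Real.exp (y i) := (Real.exp_pos _).trans_le hJ
  have hlow : ∑ i, w i * y i ≤ Real.log (∑ i, w i * Real.exp (y i)) :=
    (Real.le_log_iff_exp_le hpos).2 hJ
  have hup : Real.log (∑ i, w i * Real.exp (y i)) ≤ b := by
    rw [Real.log_le_iff_le_exp hpos]
    calc _ ≤ ∑ i, w i * Real.exp b := Finset.sum_le_sum fun i _ =>
          mul_le_mul_of_nonneg_left (Real.exp_le_exp.2 ((le_abs_self _).trans (hy i))) (hw i)
      _ = _ := by rw [← Finset.sum_mul, hw1, one_mul]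
  have hav : -b ≤ ∑ i, w i * y i := by
    calc -b = ∑ i, w i * (-b) := by rw [← Finset.sum_mul, hw1, one_mul]
      _ ≤ _ := Finset.sum_le_sum fun i _ =>
          mul_le_mul_of_nonneg_left (by linarith [neg_abs_le (y i), hy i]) (hw i)
  refine ⟨abs_le.2 ⟨by linarith, hup⟩, ?_⟩
  rw [abs_of_nonneg (by linarith)]
  by_cases hb : b ≤ 1
  · have h1 := Real.log_le_sub_one_of_pos hpos
    have h2 : ∑ i, w i * Real.exp (y i) ≤ ∑ i, (w i + w i * y i + w i * b ^ 2) := by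
      refine Finset.sum_le_sum fun i _ => ?_
      have h3 := (le_abs_self _).trans (Real.abs_exp_sub_one_sub_id_le ((hy i).trans hb))
      have h4 : y i ^ 2 ≤ b ^ 2 := sq_le_sq' (by linarith [neg_abs_le (y i), hy i])
        ((le_abs_self _).trans (hy i))
      nlinarith [hw i]
    rw [Finset.sum_add_distrib, Finset.sum_add_distrib, ← Finset.sum_mul, hw1] at h2
    nlinarith [sq_nonneg b]
  · push Not at hb
    nlinarith

/-- log-sum-exp. -/
noncomputable def lse {n : ℕ} {ι : Type*} [Fintype ι] (θ : ι → Fin n → ℝ) (l β : ℝ)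
    (x : Fin n → ℝ) : ℝ := (l / β) * Real.log (∑ i, Real.exp (β * (θ i ⬝ᵥ x)))

lemma lse_smooth {n : ℕ} {ι : Type*} [Fintype ι] [Nonempty ι] (θ : ι → Fin n → ℝ) {u l β : ℝ}
    (hu : 0 ≤ u) (hl : 0 ≤ l) (hβ : 0 < β) (hθ : ∀ i, ∑ j, (θ i j) ^ 2 ≤ u ^ 2) :
    ∃ v, SmCls (l * u) (2 * l * β * u ^ 2) (lse θ l β) v := by
  set S : (Fin n → ℝ) → ℝ := fun x => ∑ i, Real.exp (β * (θ i ⬝ᵥ x)) with hS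
  have hSpos : ∀ x, 0 < S x := fun x =>
    Finset.sum_pos (fun i _ => Real.exp_pos _) Finset.univ_nonempty
  set w : (Fin n → ℝ) → ι → ℝ := fun x i => Real.exp (β * (θ i ⬝ᵥ x)) / S x with hwdef
  have hw : ∀ x i, 0 ≤ w x i := fun x i => div_nonneg (Real.exp_pos _).le (hSpos x).le
  have hw1 : ∀ x, ∑ i, w x i = 1 := fun x => by
    rw [hwdef]; simp only; rw [← Finset.sum_div]; exact div_self (hSpos x).ne'
  have hinc : ∀ x h, lse θ l β (x + h) - lse θ l β x =
      (l / β) * Real.log (∑ i, w x i * Real.exp (β * (θ i ⬝ᵥ h))) := by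
    intro x h
    unfold lse
    rw [← mul_sub, ← Real.log_div (hSpos _).ne' (hSpos _).ne', Finset.sum_div]
    congr 2
    refine Finset.sum_congr rfl fun i _ => ?_
    rw [dotProduct_add, mul_add, Real.exp_add]
    simp only [hwdef, hS]
    ring
  have hb : ∀ h i, |β * (θ i ⬝ᵥ h)| ≤ β * (u * l1n h) := fun h i => by
    rw [abs_mul, abs_of_pos hβ]
    exact mul_le_mul_of_nonneg_left (abs_dot_le hu _ _ (hθ i)) hβ.le
  have hlb : 0 ≤ l / β := by positivity
  refine ⟨fun x j => l * ∑ i, w x i * θ i j, ?_, fun x => ?_, fun x h => ?_, fun x h => ?_⟩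
  · have : Continuous (fun x j => l * ∑ i, w x i * θ i j) := by
      have hd : ∀ i, Continuous fun x => θ i ⬝ᵥ x := fun i => by unfold dotProduct; fun_prop
      have hSc : Continuous S := by fun_prop
      have hwc : ∀ i, Continuous fun x => w x i := fun i =>
        Continuous.div (by fun_prop) hSc fun x => (hSpos x).ne'
      fun_prop
    exact this.measurable
  · calc ∑ j, (l * ∑ i, w x i * θ i j) ^ 2 ≤ ∑ j, l ^ 2 * ∑ i, w x i * θ i j ^ 2 := by
          refine Finset.sum_le_sum fun j _ => ?_
          rw [mul_pow]
          exact mul_le_mul_of_nonneg_left (Real.pow_arith_mean_le_arith_mean_pow_of_even _ _ _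
            (fun i _ => hw x i) (hw1 x) even_two) (sq_nonneg _)
      _ = l ^ 2 * ∑ i, w x i * ∑ j, θ i j ^ 2 := by
          rw [← Finset.mul_sum, Finset.sum_comm]; simp_rw [Finset.mul_sum]
      _ ≤ l ^ 2 * ∑ i, w x i * u ^ 2 := by
          refine mul_le_mul_of_nonneg_left (Finset.sum_le_sum fun i _ =>
            mul_le_mul_of_nonneg_left (hθ i) (hw x i)) (sq_nonneg _)
      _ = (l * u) ^ 2 := by rw [← Finset.sum_mul, hw1]; ring
  · have h1 := (softmax_bounds (w x) (fun i => β * (θ i ⬝ᵥ h)) _ (hw x) (hw1 x) (hb h)).2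
    have e : (fun j => l * ∑ i, w x i * θ i j) ⬝ᵥ h = (l / β) * ∑ i, w x i * (β * (θ i ⬝ᵥ h)) := by
      unfold dotProduct
      simp_rw [Finset.mul_sum, Finset.sum_mul]
      rw [Finset.sum_comm]
      refine Finset.sum_congr rfl fun i _ => Finset.sum_congr rfl fun j _ => ?_
      field_simp
    rw [hinc, e, ← mul_sub, abs_mul, abs_of_nonneg hlb]
    refine (mul_le_mul_of_nonneg_left h1 hlb).trans (le_of_eq ?_)
    field_simp
  · have h1 := (softmax_bounds (w x) (fun i => β * (θ i ⬝ᵥ h)) _ (hw x) (hw1 x) (hb h)).1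
    rw [hinc, abs_mul, abs_of_nonneg hlb]
    refine (mul_le_mul_of_nonneg_left h1 hlb).trans (le_of_eq ?_)
    field_simp

lemma fin_tail {n : ℕ} {ι : Type*} [Fintype ι] [Nonempty ι] (θ : ι → Fin n → ℝ) {u l : ℝ}
    (hu : 0 ≤ u) (hl : 0 < l) (hθ : ∀ i, ∑ j, (θ i j) ^ 2 ≤ u ^ 2) {W : (Fin n → ℝ) → ℝ}
    (hW : Integrable W (stdGaussPi n)) (hθW : ∀ i g, θ i ⬝ᵥ g ≤ W g) (a : ℝ) :
    stdGaussPi n {g | ∃ i, a ≤ θ i ⬝ᵥ g} ≤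
      ENNReal.ofReal (Real.exp (-(l * a) + (l * ∫ g, W g ∂stdGaussPi n + (l * u) ^ 2 / 2))) := by
  rw [← ofReal_measureReal]
  refine ENNReal.ofReal_le_ofReal ?_
  have key : ∀ k : ℕ, (stdGaussPi n).real {g | ∃ i, a ≤ θ i ⬝ᵥ g} ≤
      Real.exp (-(l * a) + ((l * ∫ g, W g ∂stdGaussPi n
        + l * Real.log (Fintype.card ι) * (1 / ((k : ℝ) + 1))) + (l * u) ^ 2 / 2)) := by
    intro k
    set β : ℝ := (k : ℝ) + 1 with hβdef
    have hβ : 0 < β := by positivity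
    obtain ⟨v, hv⟩ := lse_smooth θ hu hl.le hβ hθ
    have hi : Integrable (lse θ l β) (stdGaussPi n) := by
      simpa using lip_integrable hv.lip 0 1
    have hie : Integrable (fun g => Real.exp (lse θ l β g)) (stdGaussPi n) := by
      simpa using lip_integrable_exp hv.lip 0 1
    have hm := hv.exp_moment (by positivity) (by positivity)
    have hge : ∀ i g, l * (θ i ⬝ᵥ g) ≤ lse θ l β g := by
      intro i g
      have : β * (θ i ⬝ᵥ g) ≤ Real.log (∑ i, Real.exp (β * (θ i ⬝ᵥ g))) := by
        rw [Real.le_log_iff_exp_le (Finset.sum_pos (fun i _ => Real.exp_pos _)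
          Finset.univ_nonempty)]
        exact Finset.single_le_sum (f := fun i => Real.exp (β * (θ i ⬝ᵥ g)))
          (fun i _ => (Real.exp_pos _).le) (Finset.mem_univ i)
      have h2 := mul_le_mul_of_nonneg_left this (by positivity : 0 ≤ l / β)
      unfold lse
      refine le_trans (le_of_eq ?_) h2
      field_simp
    have hle : ∀ g, lse θ l β g ≤ l * W g + l * Real.log (Fintype.card ι) * (1 / β) := by
      intro g
      have hp : 0 < ∑ i, Real.exp (β * (θ i ⬝ᵥ g)) :=
        Finset.sum_pos (fun i _ => Real.exp_pos _) Finset.univ_nonempty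
      have hc : (0 : ℝ) < Fintype.card ι := by exact_mod_cast Fintype.card_pos
      have : Real.log (∑ i, Real.exp (β * (θ i ⬝ᵥ g))) ≤ β * W g + Real.log (Fintype.card ι) := by
        rw [Real.log_le_iff_le_exp hp, Real.exp_add, Real.exp_log hc]
        calc _ ≤ ∑ _i : ι, Real.exp (β * W g) := Finset.sum_le_sum fun i _ =>
              Real.exp_le_exp.2 (mul_le_mul_of_nonneg_left (hθW i g) hβ.le)
          _ = _ := by simp [mul_comm]
      have h2 := mul_le_mul_of_nonneg_left this (by positivity : 0 ≤ l / β)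
      unfold lse
      refine h2.trans (le_of_eq ?_)
      field_simp
    have hint : ∫ g, lse θ l β g ∂stdGaussPi n ≤ l * ∫ g, W g ∂stdGaussPi n
        + l * Real.log (Fintype.card ι) * (1 / β) := by
      have := integral_mono hi ((hW.const_mul l).add (integrable_const
        (l * Real.log (Fintype.card ι) * (1 / β)))) hle
      simp only [Pi.add_apply] at this
      rw [integral_add (hW.const_mul l) (integrable_const _), integral_const_mul] at this
      simpa using this
    have hmk := measure_ge_le_exp_mul_mgf (μ := stdGaussPi n) (X := lse θ l β) (t := 1) (l * a)
      (by norm_num) (by simpa using hie)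
    calc (stdGaussPi n).real {g | ∃ i, a ≤ θ i ⬝ᵥ g}
        ≤ (stdGaussPi n).real {g | l * a ≤ lse θ l β g} := by
          refine measureReal_mono ?_
          rintro g ⟨i, hig⟩
          exact (mul_le_mul_of_nonneg_left hig hl.le).trans (hge i g)
      _ ≤ Real.exp (-(l * a)) * ∫ g, Real.exp (lse θ l β g) ∂stdGaussPi n := by
          simpa [mgf] using hmk
      _ ≤ Real.exp (-(l * a)) * Real.exp (∫ g, lse θ l β g ∂stdGaussPi n + (l * u) ^ 2 / 2) :=
          mul_le_mul_of_nonneg_left hm (Real.exp_pos _).le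
      _ ≤ _ := by
          rw [← Real.exp_add, Real.exp_le_exp]
          linarith
  have hlim : Filter.Tendsto (fun k : ℕ => Real.exp (-(l * a) + ((l * ∫ g, W g ∂stdGaussPi n
        + l * Real.log (Fintype.card ι) * (1 / ((k : ℝ) + 1))) + (l * u) ^ 2 / 2))) Filter.atTop
      (nhds (Real.exp (-(l * a) + ((l * ∫ g, W g ∂stdGaussPi n
        + l * Real.log (Fintype.card ι) * 0) + (l * u) ^ 2 / 2)))) :=
    (Real.continuous_exp.tendsto _).comp (Filter.Tendsto.const_add _
      (Filter.Tendsto.add_const _ (Filter.Tendsto.const_add _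
        (Filter.Tendsto.const_mul _ tendsto_one_div_add_atTop_nhds_zero_nat))))
  have := ge_of_tendsto' hlim key
  simpa using this

/-- The supremum process. -/
noncomputable def supW {n : ℕ} (T : Set (Fin n → ℝ)) (g : Fin n → ℝ) : ℝ :=
  sSup ((fun θ => |g ⬝ᵥ θ|) '' T)

lemma supW_bdd {n : ℕ} {T : Set (Fin n → ℝ)} {u : ℝ} (hu : 0 ≤ u)
    (hT : ∀ θ ∈ T, ∑ j, (θ j) ^ 2 ≤ u ^ 2) (g : Fin n → ℝ) :
    BddAbove ((fun θ => |g ⬝ᵥ θ|) '' T) := by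
  refine ⟨u * l1n g, ?_⟩
  rintro _ ⟨θ, hθ, rfl⟩
  simp only
  rw [dotProduct_comm]
  exact abs_dot_le hu _ _ (hT θ hθ)

lemma supW_lip {n : ℕ} {T : Set (Fin n → ℝ)} (hne : T.Nonempty) {u : ℝ} (hu : 0 ≤ u)
    (hT : ∀ θ ∈ T, ∑ j, (θ j) ^ 2 ≤ u ^ 2) (x h : Fin n → ℝ) :
    |supW T (x + h) - supW T x| ≤ u * l1n h := by
  have h1 : ∀ x h, supW T (x + h) ≤ supW T x + u * l1n h := by
    intro x h
    refine csSup_le (hne.image _) ?_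
    rintro _ ⟨θ, hθ, rfl⟩
    simp only
    rw [add_dotProduct]
    refine (abs_add_le _ _).trans (add_le_add ?_ ?_)
    · exact le_csSup (supW_bdd hu hT x) ⟨θ, hθ, rfl⟩
    · rw [dotProduct_comm]
      exact abs_dot_le hu _ _ (hT θ hθ)
  have h2 := h1 x h
  have h3 := h1 (x + h) (-h)
  rw [add_neg_cancel_right] at h3
  have h4 : l1n (-h) = l1n h := by simp [l1n]
  rw [h4] at h3
  rw [abs_le]
  constructor <;> linarith

lemma sup_tail {n : ℕ} {T : Set (Fin n → ℝ)} (hne : T.Nonempty) {u l : ℝ} (hu : 0 ≤ u)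
    (hl : 0 < l) (hT : ∀ θ ∈ T, ∑ j, (θ j) ^ 2 ≤ u ^ 2) (a : ℝ) :
    stdGaussPi n {g | ∃ θ ∈ T, a < |g ⬝ᵥ θ|} ≤
      ENNReal.ofReal (Real.exp (-(l * a) + (l * ∫ g, supW T g ∂stdGaussPi n + (l * u) ^ 2 / 2))) := by
  have hW : Integrable (supW T) (stdGaussPi n) := by
    simpa using lip_integrable (supW_lip hne hu hT) 0 1
  obtain ⟨t, htT, htc, htd⟩ :=
    (TopologicalSpace.IsSeparable.of_separableSpace T).exists_countable_dense_subset
  have htne : t.Nonempty := by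
    rw [← closure_nonempty_iff]; exact hne.mono htd
  obtain ⟨e, he⟩ := htc.exists_eq_range htne
  set θ : ∀ N : ℕ, Fin (N + 1) × Bool → Fin n → ℝ :=
    fun N p => if p.2 then e p.1 else -e p.1 with hθdef
  have heT : ∀ i, e i ∈ T := fun i => htT (he ▸ Set.mem_range_self i)
  have hθ : ∀ N p, ∑ j, (θ N p j) ^ 2 ≤ u ^ 2 := by
    rintro N ⟨i, b⟩
    have := hT _ (heT i)
    cases b <;> simpa [hθdef] using this
  have hθW : ∀ N p g, θ N p ⬝ᵥ g ≤ supW T g := by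
    rintro N ⟨i, b⟩ g
    have h1 : |g ⬝ᵥ e i| ≤ supW T g := le_csSup (supW_bdd hu hT g) ⟨_, heT i, rfl⟩
    rw [dotProduct_comm] at h1
    have := abs_le.1 h1
    cases b
    · simp only [hθdef, Bool.false_eq_true, if_false, neg_dotProduct]; linarith
    · simp only [hθdef, if_true]; linarith
  set s : ℕ → Set (Fin n → ℝ) := fun N => {g | ∃ p, a ≤ θ N p ⬝ᵥ g} with hs
  have hmono : Monotone s := by
    rintro N N' hN g ⟨⟨i, b⟩, hp⟩
    exact ⟨(⟨i, by omega⟩, b), hp⟩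
  have hsub : {g | ∃ θ ∈ T, a < |g ⬝ᵥ θ|} ⊆ ⋃ N, s N := by
    rintro g ⟨θ₀, hθ₀, hg⟩
    have hopen : IsOpen {θ : Fin n → ℝ | a < |g ⬝ᵥ θ|} := by
      refine isOpen_lt continuous_const ?_
      unfold dotProduct
      fun_prop
    obtain ⟨θ₁, h1, h2⟩ := mem_closure_iff.1 (htd hθ₀) _ hopen hg
    rw [he] at h2
    obtain ⟨i, rfl⟩ := h2
    rw [Set.mem_iUnion]
    refine ⟨i, ?_⟩
    have h1' : a < |e i ⬝ᵥ g| := by rw [dotProduct_comm]; exact h1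
    rcases lt_abs.1 h1' with h3 | h3
    · exact ⟨(⟨i, by omega⟩, true), by simpa [hθdef] using h3.le⟩
    · exact ⟨(⟨i, by omega⟩, false), by simpa [hθdef] using h3.le⟩
  refine (measure_mono hsub).trans ?_
  rw [hmono.measure_iUnion]
  exact iSup_le fun N => fin_tail (θ N) hu hl (hθ N) hW (hθW N) a

lemma sup_tail' {n : ℕ} {T : Set (Fin n → ℝ)} (hne : T.Nonempty) {u l : ℝ} (hu : 0 ≤ u)
    (hl : 0 < l) (hT : ∀ θ ∈ T, ∑ j, (θ j) ^ 2 ≤ u ^ 2) (a : ℝ) :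
    stdGaussPi n {g | ∃ θ ∈ T, a ≤ |g ⬝ᵥ θ|} ≤
      ENNReal.ofReal (Real.exp (-(l * a) + (l * ∫ g, supW T g ∂stdGaussPi n + (l * u) ^ 2 / 2))) := by
  have key : ∀ k : ℕ, stdGaussPi n {g | ∃ θ ∈ T, a ≤ |g ⬝ᵥ θ|} ≤
      ENNReal.ofReal (Real.exp (-(l * (a - 1 / ((k : ℝ) + 1))) +
        (l * ∫ g, supW T g ∂stdGaussPi n + (l * u) ^ 2 / 2))) := by
    intro k
    refine le_trans (measure_mono ?_) (sup_tail hne hu hl hT (a - 1 / ((k : ℝ) + 1)))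
    rintro g ⟨θ, hθ, h⟩
    have : (0 : ℝ) < 1 / ((k : ℝ) + 1) := by positivity
    exact ⟨θ, hθ, by linarith⟩
  have hlim : Filter.Tendsto (fun k : ℕ => ENNReal.ofReal (Real.exp (-(l * (a - 1 / ((k : ℝ) + 1))) +
        (l * ∫ g, supW T g ∂stdGaussPi n + (l * u) ^ 2 / 2)))) Filter.atTop
      (nhds (ENNReal.ofReal (Real.exp (-(l * (a - 0)) +
        (l * ∫ g, supW T g ∂stdGaussPi n + (l * u) ^ 2 / 2))))) := by
    refine (ENNReal.continuous_ofReal.tendsto _).comp ((Real.continuous_exp.tendsto _).comp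
      (Filter.Tendsto.add_const _ (Filter.Tendsto.neg (Filter.Tendsto.const_mul _
        (Filter.Tendsto.const_sub _ tendsto_one_div_add_atTop_nhds_zero_nat)))))
  have := ge_of_tendsto' hlim key
  simpa using this

/-- probability bound on the "bad event" (Lemma 2). -/
theorem bad_event_bound
    {n d : ℕ} (hn : 0 < n)
    (C : Set (Fin d → ℝ)) (xstar : Fin d → ℝ) (hx : xstar ∈ C)
    (A : Matrix (Fin n) (Fin d) ℝ) (σ : ℝ) (hσ : 0 < σ)
    (u : ℝ) (hu : 0 < u)
    (hcrit : (σ / Real.sqrt n) * gaussWidth u (Kstar A C xstar) ≤ u ^ 2) :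
    stdGaussPi n
        {g | ∃ x ∈ C,
          u ≤ (1 / Real.sqrt n) * l2norm (A.mulVec (x - xstar)) ∧
          2 * u * ((1 / Real.sqrt n) * l2norm (A.mulVec (x - xstar)))
            ≤ |(σ / (n : ℝ)) * (g ⬝ᵥ A.mulVec (x - xstar))|}
      ≤ ENNReal.ofReal (Real.exp (-((n : ℝ) * u ^ 2) / (2 * σ ^ 2))) := by
  set T : Set (Fin n → ℝ) := {θ ∈ Kstar A C xstar | l2norm θ ≤ u} with hTdef
  have hnR : (0 : ℝ) < n := by exact_mod_cast hn
  have hs : 0 < Real.sqrt n := Real.sqrt_pos.2 hnR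
  have hss : Real.sqrt n * Real.sqrt n = n := Real.mul_self_sqrt hnR.le
  have hT : ∀ θ ∈ T, ∑ j, (θ j) ^ 2 ≤ u ^ 2 := by
    rintro θ ⟨-, h⟩
    unfold l2norm sqNorm at h
    exact (Real.sqrt_le_left hu.le).1 h
  have hne : T.Nonempty := by
    refine ⟨0, ⟨0, by simp, xstar, hx, by simp⟩, ?_⟩
    simp [l2norm, sqNorm, hu.le]
  have hW : gaussWidth u (Kstar A C xstar) = ∫ g, supW T g ∂stdGaussPi n := rfl
  set r : ℝ := u ^ 2 * Real.sqrt n / σ with hr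
  have hr0 : 0 < r := by positivity
  have hE : ∫ g, supW T g ∂stdGaussPi n ≤ r := by
    rw [← hW, hr, le_div_iff₀ hσ]
    rw [div_mul_eq_mul_div, div_le_iff₀ hs] at hcrit
    linarith
  have hl : 0 < r / u ^ 2 := by positivity
  refine le_trans (measure_mono ?_) ((sup_tail' hne hu.le hl hT (2 * r)).trans
    (ENNReal.ofReal_le_ofReal (Real.exp_le_exp.2 ?_)))
  · rintro g ⟨x, hxC, h1, h2⟩
    set y := A.mulVec (x - xstar) with hy
    set ρ := (1 / Real.sqrt n) * l2norm y with hρ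
    have hρ0 : 0 < ρ := hu.trans_le h1
    have hsc : ∀ c : ℝ, 0 ≤ c → l2norm (c • y) = c * l2norm y := by
      intro c hc
      unfold l2norm sqNorm
      simp only [Pi.smul_apply, smul_eq_mul, mul_pow]
      rw [← Finset.mul_sum, Real.sqrt_mul (sq_nonneg c), Real.sqrt_sq hc]
    refine ⟨((u / ρ) / Real.sqrt n) • y, ⟨⟨u / ρ, ⟨by positivity, (div_le_one hρ0).2 h1⟩, x, hxC,
      rfl⟩, ?_⟩, ?_⟩
    · rw [hsc _ (by positivity)]
      have : u / ρ / Real.sqrt n * l2norm y = u / ρ * ρ := by rw [hρ]; ring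
      rw [this, div_mul_cancel₀ _ hρ0.ne']
    · rw [dotProduct_smul, smul_eq_mul, abs_mul, abs_of_nonneg (by positivity)]
      rw [abs_mul, abs_of_pos (by positivity : 0 < σ / (n : ℝ))] at h2
      have h3 := mul_le_mul_of_nonneg_left h2 (by positivity : 0 ≤ (u / ρ) * (Real.sqrt n / σ))
      refine le_trans (le_of_eq ?_) (h3.trans (le_of_eq ?_))
      · rw [hr]; field_simp
      · rw [← hss]; field_simp; rw [Real.sqrt_sq hs.le]
  · have h3 := mul_le_mul_of_nonneg_left hE hl.le
    have e1 : r / u ^ 2 * r = n * u ^ 2 / σ ^ 2 := by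
      rw [hr, ← hss]; field_simp; rw [Real.sqrt_sq hs.le]
    have e2 : (r / u ^ 2 * u) ^ 2 = n * u ^ 2 / σ ^ 2 := by
      rw [hr, ← hss]; field_simp; rw [Real.sqrt_sq hs.le]
    have e3 : -((n : ℝ) * u ^ 2) / (2 * σ ^ 2) = -(n * u ^ 2 / σ ^ 2) / 2 := by
      field_simp
    rw [e2, e3, mul_left_comm, e1]
    linarith
end
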